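/- Fix x ∈ (0,1) and H ∈ ℝ. (i) If H·log 2 ∉ [γ(x)·A₋ + θ(x), γ(x)·A₊ + θ(x)], then there exists r > 0 such that no y ∈ B(x,r) ∩ (0,1) satisfies h_E(y) = H. (ii) If H·log 2 ∈ (γ(x)·A₋ + θ(x), γ(x)·A₊ + θ(x)), then the local multifractal formalism holds at x: d_E(x,H) = inf_{p∈ℝ} (H·p − τ_E(x,p)). -/

import Mathlib

open MeasureTheory Filter Metric Set
open scoped ENNReal Topology

noncomputable section

/-- The dyadic interval of scale `j` and index `k`: `[k 2^{-j}, (k+1) 2^{-j})`. -/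
def dyadicInt (j : ℕ) (k : ℤ) : Set ℝ :=
  Set.Ico ((k : ℝ) * 2 ^ (-(j : ℤ))) (((k : ℝ) + 1) * 2 ^ (-(j : ℤ)))

/-- The closure of the dyadic interval of scale `j` and index `k`. -/
def dyadicIntCl (j : ℕ) (k : ℤ) : Set ℝ :=
  Set.Icc ((k : ℝ) * 2 ^ (-(j : ℤ))) (((k : ℝ) + 1) * 2 ^ (-(j : ℤ)))

/-- The index of the unique dyadic interval of scale `j` containing `x`. -/
def dyadicIntIdx (j : ℕ) (x : ℝ) : ℤ := ⌊x * 2 ^ (j : ℕ)⌋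

/-- The `j`-th Birkhoff sum of `φ` for the doubling map:
`S_jφ(x) = Σ_{k=0}^{j−1} φ(2^k x)`. -/
def birkSum (φ : ℝ → ℝ) (j : ℕ) (x : ℝ) : ℝ :=
  ∑ k ∈ Finset.range j, φ (2 ^ k * x)

/-- `e_λ = sup_{x ∈ closure(λ)} exp(−γ(x) S_jφ(x) − j θ(x))` for a dyadic interval
`λ` of scale `j`. -/
def birkE (φ γ θ : ℝ → ℝ) (j : ℕ) (k : ℤ) : ℝ :=
  sSup ((fun x => Real.exp (-(γ x * birkSum φ j x) - j * θ x)) '' dyadicIntCl j k)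

/-- The lower exponent `h_E(x) = liminf_{j→∞} log e_{λ_j(x)} / log 2^{-j}` of the
dyadic family `(e_λ)`, in `[-∞,∞]` with the convention `log 0 = -∞`. -/
def birkExp (φ γ θ : ℝ → ℝ) (x : ℝ) : EReal :=
  Filter.liminf
    (fun j : ℕ =>
      if birkE φ γ θ j (dyadicIntIdx j x) = 0 then (⊤ : EReal)
      else ((Real.log (birkE φ γ θ j (dyadicIntIdx j x)) /
          Real.log ((2 : ℝ) ^ (-(j : ℤ))) : ℝ) : EReal))
    Filter.atTop

/-- The structure function `S_j(ω,p) = Σ_{λ ⊆ ω, ⟨λ⟩ = j} (e_λ)^p`. -/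
def birkStructFn (φ γ θ : ℝ → ℝ) (ω : Set ℝ) (j : ℕ) (p : ℝ) : ℝ :=
  ∑ᶠ k ∈ {k : ℤ | dyadicInt j k ⊆ ω}, birkE φ γ θ j k ^ p

/-- The scaling function `τ_E^ω(p) = liminf_{j→∞} log S_j(ω,p) / log 2^{-j}`. -/
def birkScalingFn (φ γ θ : ℝ → ℝ) (ω : Set ℝ) (p : ℝ) : ℝ :=
  Filter.liminf
    (fun j : ℕ => Real.log (birkStructFn φ γ θ ω j p) / Real.log ((2 : ℝ) ^ (-(j : ℤ))))
    Filter.atTop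

/-- The local scaling function `τ_E(x,p) = lim_{r→0⁺} τ_E^{B(x,r)∩(0,1)}(p)`; by
monotonicity in `r` it equals the supremum over `r > 0`. -/
def birkLocScalingFn (φ γ θ : ℝ → ℝ) (x : ℝ) (p : ℝ) : ℝ :=
  ⨆ r : {r : ℝ // 0 < r},
    birkScalingFn φ γ θ (Metric.ball x r.1 ∩ Set.Ioo (0 : ℝ) 1) p

/-- The partition sum appearing in the definition of the pressure:
`Σ_{λ ⊆ (0,1), ⟨λ⟩ = j} sup_{x ∈ closure(λ)} e^{q S_jφ(x)}`. -/
def pressureSum (φ : ℝ → ℝ) (q : ℝ) (j : ℕ) : ℝ :=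
  ∑ᶠ k ∈ {k : ℤ | dyadicInt j k ⊆ Set.Ioo (0 : ℝ) 1},
    sSup ((fun x => Real.exp (q * birkSum φ j x)) '' dyadicIntCl j k)

/-- The local multifractal spectrum
`d_E(x,H) = lim_{r→0⁺} dim_H {y ∈ B(x,r) ∩ (0,1) : h_E(y) = H}`; by monotonicity in
`r` the limit equals the infimum over `r > 0`. -/
def birkLocSpectrum (φ γ θ : ℝ → ℝ) (x : ℝ) (H : ℝ) : ℝ≥0∞ :=
  ⨅ (r : ℝ) (_ : 0 < r),
    dimH {y ∈ Metric.ball x r ∩ Set.Ioo (0 : ℝ) 1 | birkExp φ γ θ y = (H : EReal)}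

/-! ### Birkhoff sums of the doubling map -/

lemma birkSum_add (φ : ℝ → ℝ) (i j : ℕ) (x : ℝ) :
    birkSum φ (i + j) x = birkSum φ i x + birkSum φ j (2 ^ i * x) := by
  simp only [birkSum, Finset.sum_range_add]
  congr 1
  refine Finset.sum_congr rfl fun k _ => ?_
  rw [pow_add]; ring_nf

lemma birkSum_add_natCast {φ : ℝ → ℝ} (hper : ∀ x, φ (x + 1) = φ x) (j n : ℕ) (x : ℝ) :
    birkSum φ j (n + x) = birkSum φ j x := by
  refine Finset.sum_congr rfl fun k _ => ?_
  have h : Function.Periodic φ 1 := hper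
  have := h.nat_mul (2 ^ k * n) (2 ^ k * x)
  rw [← this]; push_cast; ring_nf

lemma abs_birkSum_le {φ : ℝ → ℝ} {B : ℝ} (hB : ∀ x, |φ x| ≤ B) (j : ℕ) (x : ℝ) :
    |birkSum φ j x| ≤ j * B := by
  refine (Finset.abs_sum_le_sum_abs _ _).trans ?_
  refine (Finset.sum_le_sum fun k _ => hB _).trans ?_
  rw [Finset.sum_const, Finset.card_range, nsmul_eq_mul]

/-- A periodic Hölder function is bounded. -/
lemma exists_abs_le_of_holder_periodic {φ : ℝ → ℝ}
    (hφ : ∃ Cφ α : ℝ, 0 < Cφ ∧ 0 < α ∧ α ≤ 1 ∧ ∀ x y : ℝ, |φ x - φ y| ≤ Cφ * |x - y| ^ α)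
    (hper : ∀ x, φ (x + 1) = φ x) : ∃ B : ℝ, 0 ≤ B ∧ ∀ x, |φ x| ≤ B := by
  obtain ⟨K, α, hK, hα, -, h⟩ := hφ
  refine ⟨|φ 0| + K, by positivity, fun x => ?_⟩
  have hp : Function.Periodic φ 1 := hper
  have hx : φ (Int.fract x) = φ x := by
    have := hp.sub_zsmul_eq ⌊x⌋ (x := x)
    rwa [zsmul_one] at this
  have h1 := h (Int.fract x) 0
  rw [sub_zero, abs_of_nonneg (Int.fract_nonneg x)] at h1
  have h2 : Int.fract x ^ α ≤ 1 :=
    Real.rpow_le_one (Int.fract_nonneg x) (Int.fract_lt_one x).le hα.le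
  rw [← hx]
  have h3 : |φ (Int.fract x)| ≤ |φ (Int.fract x) - φ 0| + |φ 0| := by
    have := abs_add_le (φ (Int.fract x) - φ 0) (φ 0)
    simpa using this
  nlinarith

/-- Bounded distortion of Birkhoff sums at dyadic scales. -/
lemma exists_distortion_of_holder {φ : ℝ → ℝ}
    (hφ : ∃ Cφ α : ℝ, 0 < Cφ ∧ 0 < α ∧ α ≤ 1 ∧ ∀ x y : ℝ, |φ x - φ y| ≤ Cφ * |x - y| ^ α) :
    ∃ C : ℝ, 0 ≤ C ∧ ∀ (j : ℕ) (x y : ℝ), |x - y| ≤ ((2 : ℝ) ^ j)⁻¹ →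
      |birkSum φ j x - birkSum φ j y| ≤ C := by
  obtain ⟨K, α, hK, hα, -, h⟩ := hφ
  set ρ : ℝ := (2⁻¹ : ℝ) ^ α with hρ
  have hρ0 : 0 < ρ := by positivity
  have hρ1 : ρ < 1 := Real.rpow_lt_one (by norm_num) (by norm_num) hα
  have hC : 0 ≤ K * (1 - ρ)⁻¹ := mul_nonneg hK.le (inv_nonneg.2 (by linarith))
  refine ⟨K * (1 - ρ)⁻¹, hC, fun j x y hxy => ?_⟩
  unfold birkSum
  rw [← Finset.sum_sub_distrib]
  refine (Finset.abs_sum_le_sum_abs _ _).trans ?_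
  have hterm : ∀ k ∈ Finset.range j,
      |φ (2 ^ k * x) - φ (2 ^ k * y)| ≤ K * ρ ^ (j - 1 - k) := by
    intro k hk
    have hk' := Finset.mem_range.1 hk
    refine (h _ _).trans (mul_le_mul_of_nonneg_left ?_ hK.le)
    have he : ρ ^ (j - 1 - k) = ((2⁻¹ : ℝ) ^ (j - 1 - k)) ^ α := by
      rw [hρ, ← Real.rpow_natCast, ← Real.rpow_mul (by norm_num), mul_comm α,
        Real.rpow_mul (by norm_num), Real.rpow_natCast]
    rw [he]
    refine Real.rpow_le_rpow (abs_nonneg _) ?_ hα.le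
    rw [← mul_sub, abs_mul, abs_of_pos (by positivity : (0 : ℝ) < 2 ^ k)]
    obtain ⟨d, rfl⟩ := Nat.exists_eq_add_of_lt hk'
    calc (2 : ℝ) ^ k * |x - y| ≤ 2 ^ k * ((2 : ℝ) ^ (k + d + 1))⁻¹ := by gcongr
      _ ≤ 2 ^ k * ((2 : ℝ) ^ (k + d))⁻¹ := by
        have : (2 : ℝ) ^ (k + d) ≤ 2 ^ (k + d + 1) :=
          pow_le_pow_right₀ (by norm_num) (by omega)
        gcongr
      _ = (2⁻¹ : ℝ) ^ (k + d + 1 - 1 - k) := by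
        rw [show k + d + 1 - 1 - k = d by omega, pow_add, inv_pow]; field_simp
  refine (Finset.sum_le_sum hterm).trans ?_
  rw [← Finset.mul_sum, Finset.sum_range_reflect (fun k => ρ ^ k) j]
  refine mul_le_mul_of_nonneg_left ?_ hK.le
  have hs := (summable_geometric_of_lt_one hρ0.le hρ1).sum_le_tsum
    (Finset.range j) (fun _ _ => by positivity)
  rwa [tsum_geometric_of_lt_one hρ0.le hρ1] at hs

/-! ### Dyadic points and dyadic intervals -/

/-- The left endpoint of the dyadic interval of scale `j` and index `k`. -/
def dyadicPt (j k : ℕ) : ℝ := k / 2 ^ j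

lemma dyadicIntCl_natCast (j k : ℕ) :
    dyadicIntCl j (k : ℤ) = Icc (dyadicPt j k) (dyadicPt j k + ((2 : ℝ) ^ j)⁻¹) := by
  unfold dyadicIntCl dyadicPt
  rw [zpow_neg, zpow_natCast]
  congr 1
  simp only [Int.cast_natCast]; ring

lemma dyadicInt_natCast (j k : ℕ) :
    dyadicInt j (k : ℤ) = Ico (dyadicPt j k) (dyadicPt j k + ((2 : ℝ) ^ j)⁻¹) := by
  unfold dyadicInt dyadicPt
  rw [zpow_neg, zpow_natCast]
  congr 1
  simp only [Int.cast_natCast]; ring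

lemma dyadicPt_mem_dyadicIntCl (j k : ℕ) : dyadicPt j k ∈ dyadicIntCl j (k : ℤ) := by
  rw [dyadicIntCl_natCast]; exact ⟨le_rfl, by simp⟩

lemma abs_sub_le_of_mem_dyadicIntCl {j k : ℕ} {x y : ℝ} (hx : x ∈ dyadicIntCl j (k : ℤ))
    (hy : y ∈ dyadicIntCl j (k : ℤ)) : |x - y| ≤ ((2 : ℝ) ^ j)⁻¹ := by
  rw [dyadicIntCl_natCast] at hx hy
  rw [abs_le]; constructor <;> linarith [hx.1, hx.2, hy.1, hy.2]

lemma dyadicPt_add_le_one {j k : ℕ} (hk : k < 2 ^ j) :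
    dyadicPt j k + ((2 : ℝ) ^ j)⁻¹ ≤ 1 := by
  have h : ((k : ℝ) + 1) ≤ 2 ^ j := by exact_mod_cast hk
  rw [dyadicPt, div_eq_mul_inv, ← add_one_mul, ← div_eq_mul_inv]
  exact (div_le_one (by positivity)).2 h

lemma dyadicIntCl_subset_Icc {j k : ℕ} (hk : k < 2 ^ j) :
    dyadicIntCl j (k : ℤ) ⊆ Icc 0 1 := by
  rw [dyadicIntCl_natCast]
  exact Icc_subset_Icc (by unfold dyadicPt; positivity) (dyadicPt_add_le_one hk)

/-- Every point of `[0,1)` lies in its dyadic interval. -/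
lemma exists_dyadicIntIdx_eq {y : ℝ} (hy : y ∈ Ico (0 : ℝ) 1) (j : ℕ) :
    ∃ k : ℕ, k < 2 ^ j ∧ dyadicIntIdx j y = k ∧ y ∈ dyadicInt j (k : ℤ) := by
  have h2 : (0 : ℝ) < 2 ^ j := by positivity
  have h0 : 0 ≤ y * 2 ^ j := mul_nonneg hy.1 h2.le
  refine ⟨⌊y * 2 ^ j⌋₊, ?_, ?_, ?_⟩
  · rw [Nat.floor_lt h0]; push_cast; nlinarith [hy.2]
  · rw [dyadicIntIdx, Int.natCast_floor_eq_floor h0]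
  · rw [dyadicInt_natCast, dyadicPt]
    have h3 := Nat.floor_le h0
    have h4 := Nat.lt_floor_add_one (y * 2 ^ j)
    constructor
    · rwa [div_le_iff₀ h2]
    · rw [← one_div, ← add_div, lt_div_iff₀ h2]; exact h4

lemma dyadicInt_subset_dyadicIntCl (j : ℕ) (k : ℤ) : dyadicInt j k ⊆ dyadicIntCl j k :=
  Ico_subset_Icc_self

lemma dyadicIntCl_natCast_subset_Icc_of_dyadicInt_subset {j k : ℕ} {a b : ℝ}
    (h : dyadicInt j (k : ℤ) ⊆ Icc a b) : dyadicIntCl j (k : ℤ) ⊆ Icc a b := by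
  rw [dyadicInt_natCast] at h
  rw [dyadicIntCl_natCast, ← closure_Ico (by simp)]
  exact closure_minimal h isClosed_Icc

open Classical in
/-- Sums over the dyadic intervals contained in a subset of `(0,1)` are finite sums. -/
lemma finsum_dyadicInt_eq (j : ℕ) {ω : Set ℝ} (hω : ω ⊆ Ioo 0 1) (F : ℤ → ℝ) :
    ∑ᶠ k ∈ {k : ℤ | dyadicInt j k ⊆ ω}, F k =
      ∑ k ∈ (Finset.range (2 ^ j)).filter (fun k : ℕ => dyadicInt j (k : ℤ) ⊆ ω), F (k : ℤ) := by
  have h : {k : ℤ | dyadicInt j k ⊆ ω} =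
      ↑(((Finset.range (2 ^ j)).filter (fun k : ℕ => dyadicInt j (k : ℤ) ⊆ ω)).image
        (fun k : ℕ => (k : ℤ))) := by
    ext k
    simp only [mem_ofPred_eq, Finset.coe_image, Finset.coe_filter, Finset.mem_range, mem_image]
    constructor
    · intro hk
      have h2 : (0 : ℝ) < 2 ^ (-(j : ℤ)) := by positivity
      have hl : (k : ℝ) * 2 ^ (-(j : ℤ)) ∈ Ioo (0 : ℝ) 1 := hω (hk ⟨le_rfl, by nlinarith⟩)
      have hk0 : 0 < k := by
        have := pos_of_mul_pos_left hl.1 h2.le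
        exact_mod_cast this
      have hk1 : k < 2 ^ j := by
        have := hl.2
        rw [zpow_neg, zpow_natCast, ← div_eq_mul_inv, div_lt_one (by positivity)] at this
        exact_mod_cast this
      lift k to ℕ using hk0.le
      exact ⟨k, ⟨by exact_mod_cast hk1, hk⟩, rfl⟩
    · rintro ⟨n, ⟨-, hn⟩, rfl⟩; exact hn
  rw [h, finsum_mem_coe_finset, Finset.sum_image (fun a _ b _ hab => Nat.cast_injective hab)]

/-! ### Partition functions and the pressure -/

/-- The partition function `Σ_{k < 2^j} e^{q S_jφ(k 2^{-j})}` over left endpoints. -/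
def birkZ (φ : ℝ → ℝ) (q : ℝ) (j : ℕ) : ℝ :=
  ∑ k ∈ Finset.range (2 ^ j), Real.exp (q * birkSum φ j (dyadicPt j k))

lemma birkZ_pos (φ : ℝ → ℝ) (q : ℝ) (j : ℕ) : 0 < birkZ φ q j :=
  Finset.sum_pos (fun _ _ => Real.exp_pos _) ⟨0, by simp⟩

lemma exp_le_birkZ (φ : ℝ → ℝ) (q : ℝ) {j k : ℕ} (hk : k < 2 ^ j) :
    Real.exp (q * birkSum φ j (dyadicPt j k)) ≤ birkZ φ q j :=
  Finset.single_le_sum (f := fun k => Real.exp (q * birkSum φ j (dyadicPt j k)))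
    (fun _ _ => (Real.exp_pos _).le) (Finset.mem_range.2 hk)

/-- `φ` has Birkhoff sums whose oscillation at scale `2^{-j}` is at most `C` for all `j`. -/
def BoundedDistortion (φ : ℝ → ℝ) (C : ℝ) : Prop :=
  ∀ (j : ℕ) (x y : ℝ), |x - y| ≤ ((2 : ℝ) ^ j)⁻¹ → |birkSum φ j x - birkSum φ j y| ≤ C

lemma BoundedDistortion.nonneg {φ : ℝ → ℝ} {C : ℝ} (h : BoundedDistortion φ C) : 0 ≤ C := by
  simpa using h 0 0 0 (by simp)

lemma BoundedDistortion.mul_le {φ : ℝ → ℝ} {C : ℝ} (h : BoundedDistortion φ C) (q : ℝ) {j : ℕ}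
    {x y : ℝ} (hxy : |x - y| ≤ ((2 : ℝ) ^ j)⁻¹) :
    q * birkSum φ j x ≤ |q| * C + q * birkSum φ j y := by
  have h1 : |q * (birkSum φ j x - birkSum φ j y)| ≤ |q| * C := by
    rw [abs_mul]; exact mul_le_mul_of_nonneg_left (h j x y hxy) (abs_nonneg q)
  linarith [le_abs_self (q * (birkSum φ j x - birkSum φ j y))]

lemma BoundedDistortion.mem_upperBounds {φ : ℝ → ℝ} {C : ℝ} (h : BoundedDistortion φ C) (q : ℝ)
    (j k : ℕ) :
    Real.exp (|q| * C) * Real.exp (q * birkSum φ j (dyadicPt j k)) ∈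
      upperBounds ((fun x => Real.exp (q * birkSum φ j x)) '' dyadicIntCl j (k : ℤ)) := by
  rintro _ ⟨x, hx, rfl⟩
  rw [← Real.exp_add]
  exact Real.exp_le_exp.2
    (h.mul_le q (abs_sub_le_of_mem_dyadicIntCl hx (dyadicPt_mem_dyadicIntCl j k)))

lemma pressureSum_le {φ : ℝ → ℝ} {C : ℝ} (h : BoundedDistortion φ C) (q : ℝ) (j : ℕ) :
    pressureSum φ q j ≤ Real.exp (|q| * C) * birkZ φ q j := by
  classical
  unfold pressureSum
  rw [finsum_dyadicInt_eq j Subset.rfl, birkZ, Finset.mul_sum]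
  refine (Finset.sum_le_sum fun k _ => csSup_le ?_ (h.mem_upperBounds q j k)).trans ?_
  · exact Nonempty.image _ ⟨_, dyadicPt_mem_dyadicIntCl j k⟩
  · exact Finset.sum_le_sum_of_subset_of_nonneg (Finset.filter_subset _ _)
      fun _ _ _ => by positivity

lemma birkZ_le {φ : ℝ → ℝ} {C : ℝ} (h : BoundedDistortion φ C) (q : ℝ) {j : ℕ} (hj : 1 ≤ j) :
    birkZ φ q j ≤ (1 + Real.exp (|q| * C)) * pressureSum φ q j := by
  classical
  set s := (Finset.range (2 ^ j)).filter
    (fun k : ℕ => dyadicInt j (k : ℤ) ⊆ Ioo (0 : ℝ) 1) with hs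
  have hsub : (Finset.range (2 ^ j)).erase 0 ⊆ s := by
    intro k hk
    rw [Finset.mem_erase, Finset.mem_range] at hk
    rw [hs, Finset.mem_filter, Finset.mem_range]
    refine ⟨hk.2, ?_⟩
    rw [dyadicInt_natCast]
    intro y hy
    have : 0 < dyadicPt j k := by
      have : 0 < k := Nat.pos_of_ne_zero hk.1
      unfold dyadicPt; positivity
    exact ⟨this.trans_le hy.1, hy.2.trans_le (dyadicPt_add_le_one hk.2)⟩
  have hterm : ∀ k : ℕ, Real.exp (q * birkSum φ j (dyadicPt j k)) ≤
      sSup ((fun x => Real.exp (q * birkSum φ j x)) '' dyadicIntCl j (k : ℤ)) := fun k =>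
    le_csSup ⟨_, h.mem_upperBounds q j k⟩ ⟨_, dyadicPt_mem_dyadicIntCl j k, rfl⟩
  have hsum : ∑ k ∈ (Finset.range (2 ^ j)).erase 0,
      Real.exp (q * birkSum φ j (dyadicPt j k)) ≤ pressureSum φ q j := by
    unfold pressureSum
    rw [finsum_dyadicInt_eq j Subset.rfl]
    refine (Finset.sum_le_sum fun k _ => hterm k).trans ?_
    exact Finset.sum_le_sum_of_subset_of_nonneg hsub
      fun k _ _ => (Real.exp_pos _).le.trans (hterm k)
  have h1 : (1 : ℕ) ∈ (Finset.range (2 ^ j)).erase 0 := by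
    rw [Finset.mem_erase, Finset.mem_range]
    exact ⟨one_ne_zero, Nat.one_lt_two_pow (by omega)⟩
  have h0 : Real.exp (q * birkSum φ j (dyadicPt j 0)) ≤
      Real.exp (|q| * C) * pressureSum φ q j := by
    have hd : |dyadicPt j 0 - dyadicPt j 1| ≤ ((2 : ℝ) ^ j)⁻¹ := by
      simp [dyadicPt]
    refine (Real.exp_le_exp.2 (h.mul_le q hd)).trans ?_
    rw [Real.exp_add]
    refine mul_le_mul_of_nonneg_left (le_trans ?_ hsum) (Real.exp_pos _).le
    exact Finset.single_le_sum (f := fun k => Real.exp (q * birkSum φ j (dyadicPt j k)))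
      (fun _ _ => (Real.exp_pos _).le) h1
  have := Finset.add_sum_erase (Finset.range (2 ^ j))
    (fun k => Real.exp (q * birkSum φ j (dyadicPt j k))) (a := 0) (by simp)
  unfold birkZ
  rw [← this]
  linarith

/-- The pressure is the growth rate of the partition functions. -/
lemma tendsto_log_birkZ {φ : ℝ → ℝ} {C : ℝ} (h : BoundedDistortion φ C) {q P : ℝ}
    (hP : Tendsto (fun j : ℕ => (1 / (j : ℝ)) * Real.log (pressureSum φ q j)) atTop (𝓝 P)) :
    Tendsto (fun j : ℕ => Real.log (birkZ φ q j) / j) atTop (𝓝 P) := by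
  have hc : ∀ c : ℝ, Tendsto (fun j : ℕ => c / (j : ℝ)) atTop (𝓝 0) := fun c =>
    tendsto_const_div_atTop_nhds_zero_nat c
  have hl := hP.sub (hc (|q| * C))
  have hu := hP.add (hc (Real.log (1 + Real.exp (|q| * C))))
  rw [sub_zero] at hl
  rw [add_zero] at hu
  refine tendsto_of_tendsto_of_tendsto_of_le_of_le' hl hu ?_ ?_
  all_goals
    filter_upwards [eventually_ge_atTop 1] with j hj
    have hj0 : (0 : ℝ) < j := by exact_mod_cast hj
    have hZ := birkZ_pos φ q j
    have hp : 0 < pressureSum φ q j :=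
      pos_of_mul_pos_right (hZ.trans_le (birkZ_le h q hj)) (by positivity)
  · have := Real.log_le_log hp (pressureSum_le h q j)
    rw [Real.log_mul (Real.exp_pos _).ne' hZ.ne', Real.log_exp] at this
    rw [one_div_mul_eq_div, ← sub_div]
    gcongr
    linarith
  · have := Real.log_le_log hZ (birkZ_le h q hj)
    rw [Real.log_mul (by positivity) hp.ne'] at this
    rw [one_div_mul_eq_div, ← add_div]
    gcongr
    linarith

/-- Concatenation: Birkhoff sums are almost additive along dyadic addresses. -/
lemma abs_birkSum_concat_le {φ : ℝ → ℝ} {C : ℝ} (h : BoundedDistortion φ C)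
    (hper : ∀ x, φ (x + 1) = φ x) (i j a : ℕ) {b : ℕ} (hb : b < 2 ^ j) :
    |birkSum φ (i + j) (dyadicPt (i + j) (2 ^ j * a + b)) -
      (birkSum φ i (dyadicPt i a) + birkSum φ j (dyadicPt j b))| ≤ C := by
  have h1 : (2 : ℝ) ^ i * dyadicPt (i + j) (2 ^ j * a + b) = a + dyadicPt j b := by
    unfold dyadicPt; rw [pow_add]; push_cast; field_simp
  have h2 : dyadicPt (i + j) (2 ^ j * a + b) - dyadicPt i a = dyadicPt j b * ((2 : ℝ) ^ i)⁻¹ := by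
    unfold dyadicPt; rw [pow_add]; push_cast; field_simp; ring
  rw [birkSum_add, h1, birkSum_add_natCast hper, add_sub_add_right_eq_sub]
  apply h
  rw [h2, abs_of_nonneg (by unfold dyadicPt; positivity)]
  have : dyadicPt j b ≤ 1 := by
    have := dyadicPt_add_le_one hb
    have h3 : (0 : ℝ) < ((2 : ℝ) ^ j)⁻¹ := by positivity
    linarith
  exact mul_le_of_le_one_left (by positivity) this

lemma sum_range_two_pow_add (F : ℕ → ℝ) (i j : ℕ) :
    ∑ k ∈ Finset.range (2 ^ (i + j)), F k =
      ∑ a ∈ Finset.range (2 ^ i), ∑ b ∈ Finset.range (2 ^ j), F (2 ^ j * a + b) := by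
  rw [← Finset.sum_product']
  have h2 : 0 < 2 ^ j := by positivity
  refine Finset.sum_nbij' (fun k => (k / 2 ^ j, k % 2 ^ j)) (fun p => 2 ^ j * p.1 + p.2)
    ?_ ?_ ?_ ?_ ?_
  · intro k hk
    simp only [Finset.mem_product, Finset.mem_range] at hk ⊢
    refine ⟨?_, Nat.mod_lt _ h2⟩
    rw [Nat.div_lt_iff_lt_mul h2, ← pow_add]; exact hk
  · rintro ⟨a, b⟩ hab
    simp only [Finset.mem_product, Finset.mem_range] at hab ⊢
    rw [pow_add]
    calc 2 ^ j * a + b < 2 ^ j * a + 2 ^ j := by omega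
      _ = 2 ^ j * (a + 1) := by ring
      _ ≤ 2 ^ j * 2 ^ i := Nat.mul_le_mul_left _ hab.1
      _ = _ := by ring
  · intro k _; exact Nat.div_add_mod k _
  · rintro ⟨a, b⟩ hab
    simp only [Finset.mem_product, Finset.mem_range] at hab
    simp [Nat.mul_add_div h2, Nat.div_eq_of_lt hab.2, Nat.mod_eq_of_lt hab.2]
  · intro k _; simp only [Nat.div_add_mod]

lemma birkZ_add_le {φ : ℝ → ℝ} {C : ℝ} (h : BoundedDistortion φ C)
    (hper : ∀ x, φ (x + 1) = φ x) (q : ℝ) (i j : ℕ) :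
    birkZ φ q (i + j) ≤ Real.exp (|q| * C) * birkZ φ q i * birkZ φ q j := by
  unfold birkZ
  rw [sum_range_two_pow_add, mul_assoc, Finset.sum_mul_sum, Finset.mul_sum]
  refine Finset.sum_le_sum fun a _ => ?_
  rw [Finset.mul_sum]
  refine Finset.sum_le_sum fun b hb => ?_
  rw [← Real.exp_add, ← Real.exp_add]
  refine Real.exp_le_exp.2 ?_
  have h1 := abs_birkSum_concat_le h hper i j a (Finset.mem_range.1 hb)
  have h2 := mul_le_mul_of_nonneg_left h1 (abs_nonneg q)
  rw [← abs_mul] at h2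
  linarith [le_abs_self (q * (birkSum φ (i + j) (dyadicPt (i + j) (2 ^ j * a + b)) -
      (birkSum φ i (dyadicPt i a) + birkSum φ j (dyadicPt j b))))]

lemma birkZ_mul_le {φ : ℝ → ℝ} {C : ℝ} (h : BoundedDistortion φ C)
    (hper : ∀ x, φ (x + 1) = φ x) (q : ℝ) (m n : ℕ) :
    birkZ φ q (m * n) ≤ (Real.exp (|q| * C) * birkZ φ q m) ^ n := by
  induction n with
  | zero => simp [birkZ, birkSum]
  | succ n ih =>
    rw [Nat.mul_succ, add_comm]
    refine (birkZ_add_le h hper q m (m * n)).trans ?_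
    rw [pow_succ, mul_comm]
    exact mul_le_mul_of_nonneg_right ih (mul_pos (Real.exp_pos _) (birkZ_pos _ _ _)).le

/-- The partition functions bound the pressure from above, at every scale. -/
lemma mul_pressure_le {φ : ℝ → ℝ} {C : ℝ} (h : BoundedDistortion φ C)
    (hper : ∀ x, φ (x + 1) = φ x) {q P : ℝ}
    (hP : Tendsto (fun j : ℕ => Real.log (birkZ φ q j) / j) atTop (𝓝 P)) {m : ℕ} (hm : 0 < m) :
    m * P ≤ |q| * C + Real.log (birkZ φ q m) := by
  have hm0 : (0 : ℝ) < m := by exact_mod_cast hm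
  have hlim := hP.comp (tendsto_id.const_mul_atTop' hm : Tendsto (fun n => m * n) atTop atTop)
  have : P ≤ (|q| * C + Real.log (birkZ φ q m)) / m := by
    refine le_of_tendsto hlim ?_
    filter_upwards [eventually_ge_atTop 1] with n hn
    have hn0 : (0 : ℝ) < n := by exact_mod_cast hn
    have h1 := Real.log_le_log (birkZ_pos _ _ _) (birkZ_mul_le h hper q m n)
    rw [Real.log_pow, Real.log_mul (Real.exp_pos _).ne' (birkZ_pos _ _ _).ne', Real.log_exp] at h1
    simp only [Function.comp, Nat.cast_mul]
    rw [div_le_div_iff₀ (by positivity) hm0]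
    nlinarith
  rw [le_div_iff₀ hm0] at this
  linarith

lemma birkZ_mul_arg_le (φ : ℝ → ℝ) (q : ℝ) {t : ℝ} (ht : 1 ≤ t) (j : ℕ) :
    birkZ φ (t * q) j ≤ birkZ φ q j ^ t := by
  have hZ := birkZ_pos φ q j
  have hterm : ∀ k ∈ Finset.range (2 ^ j),
      Real.exp (t * q * birkSum φ j (dyadicPt j k)) ≤
        birkZ φ q j ^ (t - 1) * Real.exp (q * birkSum φ j (dyadicPt j k)) := by
    intro k hk
    set e := Real.exp (q * birkSum φ j (dyadicPt j k)) with he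
    have : Real.exp (t * q * birkSum φ j (dyadicPt j k)) = e ^ (t - 1) * e := by
      rw [← Real.rpow_add_one (Real.exp_pos _).ne', sub_add_cancel, ← Real.exp_mul]
      ring_nf
    rw [this]
    refine mul_le_mul_of_nonneg_right ?_ (Real.exp_pos _).le
    exact Real.rpow_le_rpow (Real.exp_pos _).le (exp_le_birkZ φ q (Finset.mem_range.1 hk))
      (by linarith)
  refine (Finset.sum_le_sum hterm).trans ?_
  rw [← Finset.mul_sum]
  change birkZ φ q j ^ (t - 1) * birkZ φ q j ≤ _
  rw [← Real.rpow_add_one hZ.ne', sub_add_cancel]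

lemma pressure_mul_le {φ : ℝ → ℝ} {Pr : ℝ → ℝ}
    (hP : ∀ q, Tendsto (fun j : ℕ => Real.log (birkZ φ q j) / j) atTop (𝓝 (Pr q)))
    (q : ℝ) {t : ℝ} (ht : 1 ≤ t) : Pr (t * q) ≤ t * Pr q := by
  refine le_of_tendsto_of_tendsto (hP _) ((hP q).const_mul t) (Eventually.of_forall fun j => ?_)
  have h1 := Real.log_le_log (birkZ_pos _ _ _) (birkZ_mul_arg_le φ q ht j)
  rw [Real.log_rpow (birkZ_pos _ _ _)] at h1
  simp only [← mul_div_assoc]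
  gcongr

lemma mul_le_pressure_of_nonneg {φ : ℝ → ℝ} {Pr : ℝ → ℝ}
    (hP : ∀ q, Tendsto (fun j : ℕ => Real.log (birkZ φ q j) / j) atTop (𝓝 (Pr q)))
    {Ap : ℝ} (hAp : Tendsto (fun q : ℝ => Pr q / q) atTop (𝓝 Ap)) {q : ℝ} (hq : 0 ≤ q) :
    q * Ap ≤ Pr q := by
  rcases hq.eq_or_lt with rfl | hq
  · have := pressure_mul_le hP 0 (t := 2) (by norm_num)
    rw [mul_zero] at this
    linarith
  · have : Ap ≤ Pr q / q := by
      refine le_of_tendsto hAp ?_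
      filter_upwards [eventually_ge_atTop q] with p hp
      have hp0 := hq.trans_le hp
      have h1 := pressure_mul_le hP q (t := p / q) ((one_le_div hq).2 hp)
      rw [div_mul_cancel₀ _ hq.ne'] at h1
      rw [div_le_div_iff₀ hp0 hq]
      rw [div_mul_eq_mul_div, le_div_iff₀ hq] at h1
      linarith
    rw [le_div_iff₀ hq] at this
    linarith

lemma birkSum_neg (φ : ℝ → ℝ) (j : ℕ) (x : ℝ) :
    birkSum (fun y => -φ y) j x = -birkSum φ j x := by
  simp [birkSum]

lemma birkZ_neg (φ : ℝ → ℝ) (q : ℝ) (j : ℕ) :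
    birkZ (fun y => -φ y) q j = birkZ φ (-q) j := by
  simp [birkZ, birkSum_neg]

lemma BoundedDistortion.neg {φ : ℝ → ℝ} {C : ℝ} (h : BoundedDistortion φ C) :
    BoundedDistortion (fun y => -φ y) C := by
  intro j x y hxy
  rw [birkSum_neg, birkSum_neg, neg_sub_neg, abs_sub_comm]
  exact h j x y hxy

lemma tendsto_pressure_neg {Pr : ℝ → ℝ} {Am : ℝ}
    (hAm : Tendsto (fun q : ℝ => Pr q / q) atBot (𝓝 Am)) :
    Tendsto (fun q : ℝ => Pr (-q) / q) atTop (𝓝 (-Am)) := by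
  refine ((hAm.comp tendsto_neg_atTop_atBot).neg).congr fun q => ?_
  simp [div_neg]

lemma mul_le_pressure_of_nonpos {φ : ℝ → ℝ} {Pr : ℝ → ℝ}
    (hP : ∀ q, Tendsto (fun j : ℕ => Real.log (birkZ φ q j) / j) atTop (𝓝 (Pr q)))
    {Am : ℝ} (hAm : Tendsto (fun q : ℝ => Pr q / q) atBot (𝓝 Am)) {q : ℝ} (hq : q ≤ 0) :
    q * Am ≤ Pr q := by
  have := mul_le_pressure_of_nonneg (φ := fun y => -φ y) (Pr := fun q => Pr (-q))
    (fun q => by simpa only [birkZ_neg] using hP (-q)) (tendsto_pressure_neg hAm)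
    (neg_nonneg.2 hq)
  simpa using this

/-- Birkhoff sums are controlled by the partition functions. -/
lemma mul_birkSum_le {φ : ℝ → ℝ} {C : ℝ} (h : BoundedDistortion φ C) (q : ℝ) {y : ℝ}
    (hy : y ∈ Ico (0 : ℝ) 1) (j : ℕ) :
    q * birkSum φ j y ≤ |q| * C + Real.log (birkZ φ q j) := by
  obtain ⟨k, hk, -, hyk⟩ := exists_dyadicIntIdx_eq hy j
  have h1 := h.mul_le q (abs_sub_le_of_mem_dyadicIntCl (dyadicInt_subset_dyadicIntCl _ _ hyk)
    (dyadicPt_mem_dyadicIntCl j k))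
  have h2 := Real.log_le_log (Real.exp_pos _) (exp_le_birkZ φ q hk)
  rw [Real.log_exp] at h2
  linarith

lemma eventually_birkSum_div_lt {φ : ℝ → ℝ} {C : ℝ} (h : BoundedDistortion φ C) {Pr : ℝ → ℝ}
    (hP : ∀ q, Tendsto (fun j : ℕ => Real.log (birkZ φ q j) / j) atTop (𝓝 (Pr q)))
    {Ap : ℝ} (hAp : Tendsto (fun q : ℝ => Pr q / q) atTop (𝓝 Ap)) {y : ℝ}
    (hy : y ∈ Ico (0 : ℝ) 1) {c : ℝ} (hc : Ap < c) :
    ∀ᶠ j : ℕ in atTop, birkSum φ j y / j < c := by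
  obtain ⟨q, hqc, hq⟩ := ((hAp.eventually_lt_const hc).and (eventually_gt_atTop 0)).exists
  have hlim : Tendsto (fun j : ℕ => (|q| * C / j + Real.log (birkZ φ q j) / j) / q) atTop
      (𝓝 ((0 + Pr q) / q)) :=
    ((tendsto_const_div_atTop_nhds_zero_nat _).add (hP q)).div_const q
  rw [zero_add] at hlim
  filter_upwards [hlim.eventually_lt_const hqc, eventually_ge_atTop 1] with j hj hj1
  have hj0 : (0 : ℝ) < j := by exact_mod_cast hj1
  refine lt_of_le_of_lt ?_ hj
  rw [le_div_iff₀ hq, ← add_div, div_mul_eq_mul_div]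
  gcongr
  linarith [mul_birkSum_le h q hy j]

lemma eventually_lt_birkSum_div {φ : ℝ → ℝ} {C : ℝ} (h : BoundedDistortion φ C) {Pr : ℝ → ℝ}
    (hP : ∀ q, Tendsto (fun j : ℕ => Real.log (birkZ φ q j) / j) atTop (𝓝 (Pr q)))
    {Am : ℝ} (hAm : Tendsto (fun q : ℝ => Pr q / q) atBot (𝓝 Am)) {y : ℝ}
    (hy : y ∈ Ico (0 : ℝ) 1) {c : ℝ} (hc : c < Am) :
    ∀ᶠ j : ℕ in atTop, c < birkSum φ j y / j := by
  have := eventually_birkSum_div_lt h.neg (Pr := fun q => Pr (-q))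
    (fun q => by simpa only [birkZ_neg] using hP (-q)) (tendsto_pressure_neg hAm) hy
    (neg_lt_neg hc)
  filter_upwards [this] with j hj
  rw [birkSum_neg, neg_div] at hj
  linarith

/-! ### The dyadic coefficients and the lower exponent -/

/-- On a dyadic interval on which `γ` and `θ` are nearly constant, `e_λ` is comparable to
`exp(-γ S_jφ - jθ)` evaluated at any given point. -/
lemma abs_log_birkE_add_le {φ γ θ : ℝ → ℝ} {B C η c y : ℝ} (hB : ∀ x, |φ x| ≤ B)
    (h : BoundedDistortion φ C) {j k : ℕ} (hy : y ∈ dyadicIntCl j (k : ℤ)) (hc : 0 ≤ γ c)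
    (hγ : ∀ z ∈ dyadicIntCl j (k : ℤ), |γ z - γ c| ≤ η)
    (hθ : ∀ z ∈ dyadicIntCl j (k : ℤ), |θ z - θ c| ≤ η) :
    0 < birkE φ γ θ j k ∧
      |Real.log (birkE φ γ θ j k) + (γ c * birkSum φ j y + j * θ c)| ≤
        j * (η * (B + 1)) + γ c * C := by
  set E := j * (η * (B + 1)) + γ c * C with hE
  set v := -(γ c * birkSum φ j y + j * θ c) with hv
  have hη : 0 ≤ η := (abs_nonneg _).trans (hγ y hy)
  have key : ∀ z ∈ dyadicIntCl j (k : ℤ), |(-(γ z * birkSum φ j z) - j * θ z) - v| ≤ E := by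
    intro z hz
    have h1 : |(γ z - γ c) * birkSum φ j z| ≤ η * (j * B) := by
      rw [abs_mul]
      exact mul_le_mul (hγ z hz) (abs_birkSum_le hB j z) (abs_nonneg _) hη
    have h2 : |γ c * (birkSum φ j z - birkSum φ j y)| ≤ γ c * C := by
      rw [abs_mul, abs_of_nonneg hc]
      exact mul_le_mul_of_nonneg_left (h j z y (abs_sub_le_of_mem_dyadicIntCl hz hy)) hc
    have h3 : |j * (θ z - θ c)| ≤ j * η := by
      rw [abs_mul, Nat.abs_cast]
      exact mul_le_mul_of_nonneg_left (hθ z hz) (Nat.cast_nonneg j)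
    rw [abs_le] at h1 h2 h3 ⊢
    constructor <;> nlinarith [h1.1, h1.2, h2.1, h2.2, h3.1, h3.2]
  have hub : Real.exp (v + E) ∈ upperBounds
      ((fun x => Real.exp (-(γ x * birkSum φ j x) - j * θ x)) '' dyadicIntCl j (k : ℤ)) := by
    rintro _ ⟨z, hz, rfl⟩
    exact Real.exp_le_exp.2 (by linarith [(abs_le.1 (key z hz)).2])
  have hle : birkE φ γ θ j k ≤ Real.exp (v + E) := csSup_le (Nonempty.image _ ⟨y, hy⟩) hub
  have hge : Real.exp (v - E) ≤ birkE φ γ θ j k :=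
    (Real.exp_le_exp.2 (by linarith [(abs_le.1 (key y hy)).1])).trans
      (le_csSup ⟨_, hub⟩ ⟨y, hy, rfl⟩)
  have hpos := (Real.exp_pos _).trans_le hge
  have hl1 := Real.log_le_log hpos hle
  have hl2 := Real.log_le_log (Real.exp_pos _) hge
  rw [Real.log_exp] at hl1 hl2
  exact ⟨hpos, abs_le.2 ⟨by linarith, by linarith⟩⟩

lemma log_two_zpow_neg (j : ℕ) : Real.log ((2 : ℝ) ^ (-(j : ℤ))) = -(j * Real.log 2) := by
  rw [Real.log_zpow]; push_cast; ring

/-- The coarse exponents of `E` along the dyadic intervals containing `y`. -/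
def birkCoarseExp (φ γ θ : ℝ → ℝ) (y : ℝ) (j : ℕ) : ℝ :=
  Real.log (birkE φ γ θ j (dyadicIntIdx j y)) / Real.log ((2 : ℝ) ^ (-(j : ℤ)))

lemma tendsto_inv_two_pow : Tendsto (fun j : ℕ => ((2 : ℝ) ^ j)⁻¹) atTop (𝓝 0) :=
  (tendsto_pow_atTop_atTop_of_one_lt (by norm_num : (1 : ℝ) < 2)).inv_tendsto_atTop

lemma eventually_abs_log_birkE_le {φ γ θ : ℝ → ℝ} {B C : ℝ} (hB : ∀ x, |φ x| ≤ B)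
    (h : BoundedDistortion φ C) (hγc : ContinuousOn γ (Set.Icc 0 1))
    (hγpos : ∀ t ∈ Set.Icc (0 : ℝ) 1, 0 < γ t) (hθc : ContinuousOn θ (Set.Icc 0 1))
    {y : ℝ} (hy : y ∈ Ioo (0 : ℝ) 1) {ε : ℝ} (hε : 0 < ε) :
    ∀ᶠ j : ℕ in atTop, 0 < birkE φ γ θ j (dyadicIntIdx j y) ∧
      |Real.log (birkE φ γ θ j (dyadicIntIdx j y)) + (γ y * birkSum φ j y + j * θ y)| ≤ j * ε := by
  have hB0 : 0 ≤ B := (abs_nonneg _).trans (hB 0)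
  have hIcc : Icc (0 : ℝ) 1 ∈ 𝓝 y := Icc_mem_nhds hy.1 hy.2
  set η := ε / 2 / (B + 1) with hη
  have hη0 : 0 < η := by positivity
  have hηB : η * (B + 1) = ε / 2 := by rw [hη]; field_simp
  obtain ⟨δ, hδ, hball⟩ := Metric.eventually_nhds_iff.1
    (((hγc.continuousAt hIcc).eventually (Metric.ball_mem_nhds _ hη0)).and
      ((hθc.continuousAt hIcc).eventually (Metric.ball_mem_nhds _ hη0)))
  have hC : ∀ᶠ j : ℕ in atTop, γ y * C / (ε / 2) ≤ j := tendsto_natCast_atTop_atTop.eventually_ge_atTop _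
  filter_upwards [tendsto_inv_two_pow.eventually_lt_const hδ, hC] with j hj hjC
  obtain ⟨k, hk, hidx, hyk⟩ := exists_dyadicIntIdx_eq (Ioo_subset_Ico_self hy) j
  have hycl := dyadicInt_subset_dyadicIntCl _ _ hyk
  have hz : ∀ z ∈ dyadicIntCl j (k : ℤ), dist z y < δ := fun z hz =>
    (abs_sub_le_of_mem_dyadicIntCl hz hycl).trans_lt hj
  have hγy : 0 ≤ γ y := (hγpos y (Ioo_subset_Icc_self hy)).le
  rw [hidx]
  obtain ⟨h1, h2⟩ := abs_log_birkE_add_le hB h hycl hγy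
    (fun z hz' => (hball (hz z hz')).1.le) (fun z hz' => (hball (hz z hz')).2.le)
  refine ⟨h1, h2.trans ?_⟩
  rw [hηB]
  rw [div_le_iff₀ (by positivity)] at hjC
  linarith

lemma tendsto_birkCoarseExp_sub {φ γ θ : ℝ → ℝ} {B C : ℝ} (hB : ∀ x, |φ x| ≤ B)
    (h : BoundedDistortion φ C) (hγc : ContinuousOn γ (Set.Icc 0 1))
    (hγpos : ∀ t ∈ Set.Icc (0 : ℝ) 1, 0 < γ t) (hθc : ContinuousOn θ (Set.Icc 0 1))
    {y : ℝ} (hy : y ∈ Ioo (0 : ℝ) 1) :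
    Tendsto (fun j : ℕ => birkCoarseExp φ γ θ y j * Real.log 2 -
      (γ y * (birkSum φ j y / j) + θ y)) atTop (𝓝 0) := by
  rw [Metric.tendsto_nhds]
  intro ε hε
  filter_upwards [eventually_abs_log_birkE_le hB h hγc hγpos hθc hy (half_pos hε),
    eventually_ge_atTop 1] with j hj hj1
  have hj0 : (0 : ℝ) < j := by exact_mod_cast hj1
  have hl2 : 0 < Real.log 2 := Real.log_pos (by norm_num)
  have heq : birkCoarseExp φ γ θ y j * Real.log 2 - (γ y * (birkSum φ j y / j) + θ y) =
      -(Real.log (birkE φ γ θ j (dyadicIntIdx j y)) + (γ y * birkSum φ j y + j * θ y)) / j := by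
    unfold birkCoarseExp
    rw [log_two_zpow_neg]; field_simp; ring
  rw [Real.dist_eq, sub_zero, heq, abs_div, abs_neg, Nat.abs_cast, div_lt_iff₀ hj0]
  nlinarith [hj.2]

lemma birkExp_eq_liminf {φ γ θ : ℝ → ℝ} {B C : ℝ} (hB : ∀ x, |φ x| ≤ B)
    (h : BoundedDistortion φ C) (hγc : ContinuousOn γ (Set.Icc 0 1))
    (hγpos : ∀ t ∈ Set.Icc (0 : ℝ) 1, 0 < γ t) (hθc : ContinuousOn θ (Set.Icc 0 1))
    {y : ℝ} (hy : y ∈ Ioo (0 : ℝ) 1) :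
    birkExp φ γ θ y = liminf (fun j : ℕ => (birkCoarseExp φ γ θ y j : EReal)) atTop := by
  refine liminf_congr ?_
  filter_upwards [eventually_abs_log_birkE_le hB h hγc hγpos hθc hy one_pos] with j hj
  rw [if_neg hj.1.ne']
  rfl

/-- If the Birkhoff averages at `y` converge, they determine the exponent at `y`. -/
lemma birkExp_eq_of_tendsto {φ γ θ : ℝ → ℝ} {B C : ℝ} (hB : ∀ x, |φ x| ≤ B)
    (h : BoundedDistortion φ C) (hγc : ContinuousOn γ (Set.Icc 0 1))
    (hγpos : ∀ t ∈ Set.Icc (0 : ℝ) 1, 0 < γ t) (hθc : ContinuousOn θ (Set.Icc 0 1))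
    {y : ℝ} (hy : y ∈ Ioo (0 : ℝ) 1) {a : ℝ}
    (ha : Tendsto (fun j : ℕ => birkSum φ j y / j) atTop (𝓝 a)) :
    birkExp φ γ θ y = ((γ y * a + θ y) / Real.log 2 : ℝ) := by
  have hl2 : 0 < Real.log 2 := Real.log_pos (by norm_num)
  have h1 := (tendsto_birkCoarseExp_sub hB h hγc hγpos hθc hy).add
    ((ha.const_mul (γ y)).add_const (θ y))
  have h2 := h1.div_const (Real.log 2)
  simp only [sub_add_cancel, zero_add, mul_div_cancel_right₀ _ hl2.ne'] at h2
  rw [birkExp_eq_liminf hB h hγc hγpos hθc hy]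
  exact ((continuous_coe_real_ereal.tendsto _).comp h2).liminf_eq

/-- The exponent at `y` is approached by the Birkhoff averages at `y` infinitely often. -/
lemma frequently_abs_sub_lt_of_birkExp_eq {φ γ θ : ℝ → ℝ} {B C : ℝ} (hB : ∀ x, |φ x| ≤ B)
    (h : BoundedDistortion φ C) (hγc : ContinuousOn γ (Set.Icc 0 1))
    (hγpos : ∀ t ∈ Set.Icc (0 : ℝ) 1, 0 < γ t) (hθc : ContinuousOn θ (Set.Icc 0 1))
    {y : ℝ} (hy : y ∈ Ioo (0 : ℝ) 1) {H : ℝ} (hH : birkExp φ γ θ y = (H : EReal))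
    {ε : ℝ} (hε : 0 < ε) :
    ∃ᶠ j : ℕ in atTop, |γ y * (birkSum φ j y / j) + θ y - H * Real.log 2| < ε := by
  have hl2 : 0 < Real.log 2 := Real.log_pos (by norm_num)
  rw [birkExp_eq_liminf hB h hγc hγpos hθc hy] at hH
  set κ := ε / 2 / Real.log 2 with hκ
  have hκ0 : 0 < κ := by positivity
  have hκl : κ * Real.log 2 = ε / 2 := by rw [hκ]; field_simp
  have hup : ∃ᶠ j : ℕ in atTop, (birkCoarseExp φ γ θ y j : EReal) < ((H + κ : ℝ) : EReal) := by
    refine frequently_lt_of_liminf_lt (by isBoundedDefault) ?_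
    rw [hH]; exact_mod_cast (by linarith : H < H + κ)
  have hlo : ∀ᶠ j : ℕ in atTop, ((H - κ : ℝ) : EReal) < (birkCoarseExp φ γ θ y j : EReal) := by
    refine eventually_lt_of_lt_liminf ?_ (by isBoundedDefault)
    rw [hH]; exact_mod_cast (by linarith : H - κ < H)
  have herr := Metric.tendsto_nhds.1 (tendsto_birkCoarseExp_sub hB h hγc hγpos hθc hy) _
    (half_pos hε)
  refine (hup.and_eventually (hlo.and herr)).mono ?_
  rintro j ⟨h1, h2, h3⟩
  rw [EReal.coe_lt_coe_iff] at h1 h2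
  rw [Real.dist_eq, sub_zero, abs_lt] at h3
  have h4 := mul_lt_mul_of_pos_right h1 hl2
  have h5 := mul_lt_mul_of_pos_right h2 hl2
  rw [abs_lt]
  constructor <;> nlinarith

/-! ### Upper bound for Hausdorff dimensions -/

lemma tendsto_birkZ_weight {φ : ℝ → ℝ} {q P : ℝ}
    (hP : Tendsto (fun j : ℕ => Real.log (birkZ φ q j) / j) atTop (𝓝 P)) {b : ℝ} (hb : P < b) :
    ∃ κ : ℝ, 0 < κ ∧ ∀ᶠ j : ℕ in atTop, birkZ φ q j * Real.exp (-(j * b)) ≤ Real.exp (-κ) ^ j := by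
  refine ⟨(b - P) / 2, by linarith, ?_⟩
  filter_upwards [hP.eventually_lt_const (show P < (P + b) / 2 by linarith),
    eventually_ge_atTop 1] with j hj hj1
  have hj0 : (0 : ℝ) < j := by exact_mod_cast hj1
  rw [div_lt_iff₀ hj0] at hj
  rw [← Real.exp_log (birkZ_pos φ q j), ← Real.exp_add, ← Real.exp_nat_mul]
  exact Real.exp_le_exp.2 (by nlinarith)

/-- The set of points whose Birkhoff sums are infinitely often as large as prescribed has
dimension bounded through the pressure. -/
lemma dimH_setOf_frequently_le {φ : ℝ → ℝ} {C : ℝ} (h : BoundedDistortion φ C) {q P : ℝ}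
    (hP : Tendsto (fun j : ℕ => Real.log (birkZ φ q j) / j) atTop (𝓝 P)) {a : ℝ} {s : NNReal}
    (hs : 0 < s) (ha : P - a < s * Real.log 2) :
    dimH {y ∈ Ioo (0 : ℝ) 1 | ∃ᶠ j : ℕ in atTop, j * a ≤ q * birkSum φ j y} ≤ s := by
  classical
  obtain ⟨κ, hκ, hdecay⟩ := tendsto_birkZ_weight hP (b := a + s * Real.log 2) (by linarith)
  set E := {y ∈ Ioo (0 : ℝ) 1 | ∃ᶠ j : ℕ in atTop, j * a ≤ q * birkSum φ j y} with hE
  set good : ℕ → ℕ → Prop := fun j k =>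
    k < 2 ^ j ∧ j * a ≤ |q| * C + q * birkSum φ j (dyadicPt j k) with hgood
  set t : ℕ → ℕ × ℕ → Set ℝ := fun n p =>
    if good (p.1 + n) p.2 then dyadicIntCl (p.1 + n) (p.2 : ℤ) else ∅ with ht
  have hdiam : ∀ j k : ℕ, Metric.ediam (dyadicIntCl j (k : ℤ)) = ENNReal.ofReal ((2 : ℝ) ^ j)⁻¹ := by
    intro j k; rw [dyadicIntCl_natCast, Real.ediam_Icc]; congr 1; ring
  -- the mass of the covering at level `j`
  set f : ℕ → ℝ≥0∞ := fun j => ENNReal.ofReal (Real.exp (|q| * C) * Real.exp (-κ) ^ j) with hf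
  have hρ : Real.exp (-κ) < 1 := Real.exp_zero ▸ Real.exp_lt_exp.2 (by linarith)
  have hsum : Summable fun j : ℕ => Real.exp (|q| * C) * Real.exp (-κ) ^ j :=
    (summable_geometric_of_lt_one (Real.exp_pos _).le hρ).mul_left _
  have hfin : ∑' j, f j ≠ ∞ := hsum.tsum_ofReal_ne_top
  have htail := ENNReal.tendsto_sum_nat_add f hfin
  have hrow : ∀ᶠ j : ℕ in atTop, ∑' k : ℕ,
      Metric.ediam (if good j k then dyadicIntCl j (k : ℤ) else ∅) ^ (s : ℝ) ≤ f j := by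
    filter_upwards [hdecay] with j hj
    have hterm : ∀ k : ℕ, Metric.ediam (if good j k then dyadicIntCl j (k : ℤ) else ∅) ^ (s : ℝ) ≤
        if k ∈ Finset.range (2 ^ j) then ENNReal.ofReal (Real.exp (|q| * C) *
          (Real.exp (q * birkSum φ j (dyadicPt j k)) *
            Real.exp (-(j * (a + s * Real.log 2))))) else 0 := by
      intro k
      split_ifs with h1 h2 h2
      · rw [hdiam, ENNReal.ofReal_rpow_of_pos (by positivity)]
        refine ENNReal.ofReal_le_ofReal ?_
        have : (((2 : ℝ) ^ j)⁻¹) ^ (s : ℝ) = Real.exp (-(j * (s * Real.log 2))) := by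
          rw [Real.rpow_def_of_pos (by positivity), Real.log_inv, Real.log_pow]
          congr 1; ring
        rw [this, ← Real.exp_add, ← Real.exp_add]
        exact Real.exp_le_exp.2 (by nlinarith [h1.2])
      · exact absurd (Finset.mem_range.2 h1.1) h2
      · simp [hs]
      · simp [hs]
    refine (ENNReal.tsum_le_tsum hterm).trans ?_
    rw [tsum_eq_sum (s := Finset.range (2 ^ j)) (by intro k hk; rw [if_neg hk])]
    rw [Finset.sum_congr rfl (fun k hk => if_pos hk),
      ← ENNReal.ofReal_sum_of_nonneg (fun _ _ => by positivity)]
    refine ENNReal.ofReal_le_ofReal ?_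
    rw [← Finset.mul_sum, ← Finset.sum_mul]
    exact mul_le_mul_of_nonneg_left hj (Real.exp_pos _).le
  have hcover : ∀ n : ℕ, E ⊆ ⋃ p, t n p := by
    intro n y hy
    obtain ⟨hy01, hfreq⟩ := hy
    obtain ⟨j, hj, hjn⟩ := (hfreq.and_eventually (eventually_ge_atTop n)).exists
    obtain ⟨k, hk, -, hyk⟩ := exists_dyadicIntIdx_eq (Ioo_subset_Ico_self hy01) j
    have hycl := dyadicInt_subset_dyadicIntCl _ _ hyk
    rw [mem_iUnion]
    refine ⟨(j - n, k), ?_⟩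
    have hg : good j k := ⟨hk, hj.trans
      (h.mul_le q (abs_sub_le_of_mem_dyadicIntCl hycl (dyadicPt_mem_dyadicIntCl j k)))⟩
    simp only [ht, Nat.sub_add_cancel hjn]
    rwa [if_pos hg]
  have hr : Tendsto (fun n : ℕ => ENNReal.ofReal ((2 : ℝ) ^ n)⁻¹) atTop (𝓝 0) := by
    have := (ENNReal.continuous_ofReal.tendsto 0).comp tendsto_inv_two_pow
    rwa [ENNReal.ofReal_zero] at this
  have hbound := Measure.hausdorffMeasure_le_liminf_tsum (l := atTop) (s : ℝ) E _ hr t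
    (Eventually.of_forall fun n p => by
      simp only [ht]
      split_ifs
      · rw [hdiam]
        refine ENNReal.ofReal_le_ofReal (inv_anti₀ (by positivity) ?_)
        exact pow_le_pow_right₀ (by norm_num) (by omega)
      · simp)
    (Eventually.of_forall hcover)
  have hzero : μH[(s : ℝ)] E = 0 := by
    refine le_antisymm (hbound.trans ?_) bot_le
    refine (liminf_le_liminf ?_).trans htail.liminf_eq.le
    obtain ⟨N, hN⟩ := eventually_atTop.1 hrow
    filter_upwards [eventually_ge_atTop N] with n hn
    rw [ENNReal.tsum_prod']
    exact ENNReal.tsum_le_tsum fun j => hN (j + n) (by omega)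
  exact dimH_le_of_hausdorffMeasure_ne_top (by rw [hzero]; exact ENNReal.zero_ne_top)

/-! ### The local scaling function -/

lemma dyadicIntCl_concat_subset (i j a : ℕ) {b : ℕ} (hb : b < 2 ^ j) :
    dyadicIntCl (i + j) ((2 ^ j * a + b : ℕ) : ℤ) ⊆ dyadicIntCl i (a : ℤ) := by
  rw [dyadicIntCl_natCast, dyadicIntCl_natCast]
  have hb' : (b : ℝ) + 1 ≤ 2 ^ j := by exact_mod_cast hb
  have hi : (0 : ℝ) < 2 ^ i := by positivity
  have hj : (0 : ℝ) < 2 ^ j := by positivity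
  refine Icc_subset_Icc ?_ ?_
  · unfold dyadicPt
    rw [pow_add]; push_cast
    rw [div_le_div_iff₀ hi (by positivity)]
    have : 0 ≤ (b : ℝ) * 2 ^ i := by positivity
    nlinarith
  · unfold dyadicPt
    rw [pow_add]; push_cast
    rw [← one_div, ← add_div, ← one_div, ← add_div, div_le_div_iff₀ (by positivity) hi]
    nlinarith [mul_le_mul_of_nonneg_left hb' hi.le]

/-- Every neighbourhood of a point of `(0,1)` contains a closed dyadic interval. -/
lemma exists_dyadicIntCl_subset {x r : ℝ} (hx : x ∈ Ioo (0 : ℝ) 1) (hr : 0 < r) :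
    ∃ i a : ℕ, a < 2 ^ i ∧ dyadicIntCl i (a : ℤ) ⊆ ball x r ∩ Ioo 0 1 := by
  obtain ⟨δ, hδ, hball⟩ := Metric.isOpen_iff.1 (isOpen_ball.inter isOpen_Ioo) x
    (⟨mem_ball_self hr, hx⟩ : x ∈ ball x r ∩ Ioo (0 : ℝ) 1)
  obtain ⟨i, hi⟩ := (tendsto_inv_two_pow.eventually_lt_const hδ).exists
  obtain ⟨a, ha, -, hxa⟩ := exists_dyadicIntIdx_eq (Ioo_subset_Ico_self hx) i
  refine ⟨i, a, ha, fun y hy => hball ?_⟩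
  exact (abs_sub_le_of_mem_dyadicIntCl hy (dyadicInt_subset_dyadicIntCl _ _ hxa)).trans_lt hi

lemma rpow_birkE_le_and_ge {φ γ θ : ℝ → ℝ} {B C η c : ℝ} (hB : ∀ x, |φ x| ≤ B)
    (h : BoundedDistortion φ C) (j k : ℕ) (hc : 0 ≤ γ c)
    (hγ : ∀ z ∈ dyadicIntCl j (k : ℤ), |γ z - γ c| ≤ η)
    (hθ : ∀ z ∈ dyadicIntCl j (k : ℤ), |θ z - θ c| ≤ η) (p : ℝ) :
    birkE φ γ θ j k ^ p ≤ Real.exp (|p| * (γ c * C) + j * (|p| * (η * (B + 1)) - p * θ c)) *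
        Real.exp (-p * γ c * birkSum φ j (dyadicPt j k)) ∧
      Real.exp (-(|p| * (γ c * C)) - j * (|p| * (η * (B + 1)) + p * θ c)) *
        Real.exp (-p * γ c * birkSum φ j (dyadicPt j k)) ≤ birkE φ γ θ j k ^ p := by
  obtain ⟨hpos, hlog⟩ := abs_log_birkE_add_le hB h (dyadicPt_mem_dyadicIntCl j k) hc hγ hθ
  have h1 := mul_le_mul_of_nonneg_left hlog (abs_nonneg p)
  rw [← abs_mul, abs_le] at h1
  rw [Real.rpow_def_of_pos hpos, ← Real.exp_add, ← Real.exp_add]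
  constructor <;> refine Real.exp_le_exp.2 ?_ <;> nlinarith [h1.1, h1.2]

lemma birkStructFn_le {φ γ θ : ℝ → ℝ} {B C η x r : ℝ} (hB : ∀ x, |φ x| ≤ B)
    (h : BoundedDistortion φ C) (hc : 0 ≤ γ x)
    (hγ : ∀ z ∈ Icc 0 1 ∩ closedBall x r, |γ z - γ x| ≤ η)
    (hθ : ∀ z ∈ Icc 0 1 ∩ closedBall x r, |θ z - θ x| ≤ η) (p : ℝ) (j : ℕ) :
    birkStructFn φ γ θ (ball x r ∩ Ioo 0 1) j p ≤
      Real.exp (|p| * (γ x * C) + j * (|p| * (η * (B + 1)) - p * θ x)) *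
        birkZ φ (-p * γ x) j := by
  classical
  unfold birkStructFn
  rw [finsum_dyadicInt_eq j inter_subset_right, birkZ, Finset.mul_sum]
  refine (Finset.sum_le_sum fun k hk => ?_).trans
    (Finset.sum_le_sum_of_subset_of_nonneg (Finset.filter_subset _ _) fun _ _ _ => by positivity)
  rw [Finset.mem_filter, Finset.mem_range] at hk
  have hsub : dyadicIntCl j (k : ℤ) ⊆ Icc 0 1 ∩ closedBall x r := by
    refine subset_inter (dyadicIntCl_subset_Icc hk.1) ?_
    rw [Real.closedBall_eq_Icc]
    refine dyadicIntCl_natCast_subset_Icc_of_dyadicInt_subset (hk.2.trans ?_)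
    rw [← Real.closedBall_eq_Icc]
    exact inter_subset_left.trans ball_subset_closedBall
  exact (rpow_birkE_le_and_ge hB h j k hc (fun z hz => hγ z (hsub hz))
    (fun z hz => hθ z (hsub hz)) p).1

lemma le_birkStructFn {φ γ θ : ℝ → ℝ} {B C η x : ℝ} {ω : Set ℝ} (hB : ∀ x, |φ x| ≤ B)
    (h : BoundedDistortion φ C) (hper : ∀ x, φ (x + 1) = φ x) (hc : 0 ≤ γ x) {i a : ℕ}
    (ha : a < 2 ^ i) (hω : ω ⊆ Ioo 0 1) (hsub : dyadicIntCl i (a : ℤ) ⊆ ω)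
    (hγ : ∀ z ∈ dyadicIntCl i (a : ℤ), |γ z - γ x| ≤ η)
    (hθ : ∀ z ∈ dyadicIntCl i (a : ℤ), |θ z - θ x| ≤ η) (p : ℝ) :
    ∃ K : ℝ, ∀ᶠ j : ℕ in atTop,
      Real.exp (-K - j * (|p| * (η * (B + 1)) + p * θ x)) * birkZ φ (-p * γ x) j ≤
        birkStructFn φ γ θ ω j p := by
  classical
  set q := -p * γ x with hq
  refine ⟨|p| * (γ x * C) + |q| * (i * B + C) + (|q| * C + Real.log (birkZ φ q i)), ?_⟩
  filter_upwards [eventually_ge_atTop i] with j hj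
  obtain ⟨n, rfl⟩ := Nat.exists_eq_add_of_le hj
  set W := Real.exp (-(|p| * (γ x * C)) - (i + n : ℕ) * (|p| * (η * (B + 1)) + p * θ x)) with hW
  -- restrict to the descendants of the dyadic interval
  have hstep : ∑ b ∈ Finset.range (2 ^ n), W *
      (Real.exp (-(|q| * (i * B + C))) * Real.exp (q * birkSum φ n (dyadicPt n b))) ≤
      birkStructFn φ γ θ ω (i + n) p := by
    unfold birkStructFn
    rw [finsum_dyadicInt_eq (i + n) hω]
    have hinj : Function.Injective (fun b : ℕ => 2 ^ n * a + b) := add_right_injective _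
    have himg : (Finset.range (2 ^ n)).image (fun b : ℕ => 2 ^ n * a + b) ⊆
        (Finset.range (2 ^ (i + n))).filter
          (fun k : ℕ => dyadicInt (i + n) (k : ℤ) ⊆ ω) := by
      intro k hk
      obtain ⟨b, hb, rfl⟩ := Finset.mem_image.1 hk
      rw [Finset.mem_range] at hb
      rw [Finset.mem_filter, Finset.mem_range]
      constructor
      · rw [pow_add]
        calc 2 ^ n * a + b < 2 ^ n * a + 2 ^ n := by omega
          _ = 2 ^ n * (a + 1) := by ring
          _ ≤ 2 ^ n * 2 ^ i := Nat.mul_le_mul_left _ ha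
          _ = _ := by ring
      · exact (dyadicInt_subset_dyadicIntCl _ _).trans
          ((dyadicIntCl_concat_subset i n a hb).trans hsub)
    refine le_trans ?_ (Finset.sum_le_sum_of_subset_of_nonneg himg fun k _ _ => ?_)
    · rw [Finset.sum_image hinj.injOn]
      refine Finset.sum_le_sum fun b hb => ?_
      rw [Finset.mem_range] at hb
      have hcl := dyadicIntCl_concat_subset i n a hb
      refine le_trans ?_ (rpow_birkE_le_and_ge hB h (i + n) (2 ^ n * a + b) hc
        (fun z hz => hγ z (hcl hz)) (fun z hz => hθ z (hcl hz)) p).2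
      refine mul_le_mul_of_nonneg_left ?_ (Real.exp_pos _).le
      rw [← Real.exp_add]
      refine Real.exp_le_exp.2 ?_
      have h1 := abs_birkSum_concat_le h hper i n a hb
      have h2 := abs_birkSum_le hB i (dyadicPt i a)
      have h3 : |birkSum φ (i + n) (dyadicPt (i + n) (2 ^ n * a + b)) -
          birkSum φ n (dyadicPt n b)| ≤ i * B + C := by
        rw [abs_le] at h1 h2 ⊢
        constructor <;> linarith [h1.1, h1.2, h2.1, h2.2]
      have h4 := mul_le_mul_of_nonneg_left h3 (abs_nonneg q)
      rw [← abs_mul, abs_le] at h4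
      linarith [h4.1]
    · refine Real.rpow_nonneg (Real.sSup_nonneg ?_) _
      rintro _ ⟨z, _, rfl⟩
      exact (Real.exp_pos _).le
  refine le_trans ?_ hstep
  rw [← Finset.mul_sum, ← Finset.mul_sum]
  change _ ≤ W * (_ * birkZ φ q n)
  have hZ : birkZ φ q (i + n) ≤ Real.exp (|q| * C + Real.log (birkZ φ q i)) * birkZ φ q n := by
    rw [Real.exp_add, Real.exp_log (birkZ_pos _ _ _)]
    exact birkZ_add_le h hper q i n
  refine (mul_le_mul_of_nonneg_left hZ (Real.exp_pos _).le).trans (le_of_eq ?_)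
  rw [hW, ← mul_assoc (Real.exp _) (Real.exp _) (birkZ φ q n),
    ← mul_assoc (Real.exp _) (Real.exp _) (birkZ φ q n), ← Real.exp_add, ← Real.exp_add]
  congr 2
  ring

lemma le_liminf_and_liminf_le {f u v : ℕ → ℝ} {a b : ℝ} (hu : Tendsto u atTop (𝓝 a))
    (hv : Tendsto v atTop (𝓝 b)) (huf : ∀ᶠ j in atTop, u j ≤ f j)
    (hfv : ∀ᶠ j in atTop, f j ≤ v j) : a ≤ liminf f atTop ∧ liminf f atTop ≤ b := by
  have hfa : IsBoundedUnder (· ≤ ·) atTop f := hv.isBoundedUnder_le.mono_le hfv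
  have hfb : IsBoundedUnder (· ≥ ·) atTop f := hu.isBoundedUnder_ge.mono_ge huf
  constructor
  · rw [← hu.liminf_eq]
    exact liminf_le_liminf huf hu.isBoundedUnder_ge hfa.isCoboundedUnder_ge
  · rw [← hv.liminf_eq]
    exact liminf_le_liminf hfv hfb hv.isBoundedUnder_le.isCoboundedUnder_ge

/-- Two-sided comparison of the structure functions with the partition functions bounds the
scaling function. -/
lemma birkScalingFn_bounds {φ γ θ : ℝ → ℝ} {ω : Set ℝ} {p q P K₁ K₂ A₁ A₂ : ℝ}
    (hP : Tendsto (fun j : ℕ => Real.log (birkZ φ q j) / j) atTop (𝓝 P))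
    (hlo : ∀ᶠ j : ℕ in atTop,
      Real.exp (-K₁ - j * A₁) * birkZ φ q j ≤ birkStructFn φ γ θ ω j p)
    (hup : ∀ᶠ j : ℕ in atTop,
      birkStructFn φ γ θ ω j p ≤ Real.exp (K₂ + j * A₂) * birkZ φ q j) :
    -(A₂ + P) / Real.log 2 ≤ birkScalingFn φ γ θ ω p ∧
      birkScalingFn φ γ θ ω p ≤ (A₁ - P) / Real.log 2 := by
  have hl2 : 0 < Real.log 2 := Real.log_pos (by norm_num)
  have hK : ∀ c : ℝ, Tendsto (fun j : ℕ => c / (j : ℝ)) atTop (𝓝 0) := fun c =>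
    tendsto_const_div_atTop_nhds_zero_nat c
  have hu : Tendsto (fun j : ℕ => -(K₂ / j + A₂ + Real.log (birkZ φ q j) / j) / Real.log 2)
      atTop (𝓝 (-(0 + A₂ + P) / Real.log 2)) :=
    ((((hK K₂).add_const A₂).add hP).neg).div_const _
  have hv : Tendsto (fun j : ℕ => (K₁ / j + A₁ - Real.log (birkZ φ q j) / j) / Real.log 2)
      atTop (𝓝 ((0 + A₁ - P) / Real.log 2)) :=
    (((hK K₁).add_const A₁).sub hP).div_const _
  rw [zero_add] at hu hv
  refine le_liminf_and_liminf_le hu hv ?_ ?_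
  all_goals
    filter_upwards [hlo, hup, eventually_ge_atTop 1] with j h1 h2 hj1
    have hj0 : (0 : ℝ) < j := by exact_mod_cast hj1
    have hZ := birkZ_pos φ q j
    have hpos : 0 < birkStructFn φ γ θ ω j p := lt_of_lt_of_le (by positivity) h1
    rw [log_two_zpow_neg, div_neg, ← neg_div, div_mul_eq_div_div]
    gcongr
  · have h3 := Real.log_le_log hpos h2
    rw [Real.log_mul (Real.exp_pos _).ne' hZ.ne', Real.log_exp] at h3
    rw [le_div_iff₀ hj0]
    have : -(K₂ / j + A₂ + Real.log (birkZ φ q j) / j) * j =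
      -(K₂ + j * A₂ + Real.log (birkZ φ q j)) := by field_simp
    linarith
  · have h3 := Real.log_le_log (by positivity) h1
    rw [Real.log_mul (Real.exp_pos _).ne' hZ.ne', Real.log_exp] at h3
    rw [div_le_iff₀ hj0]
    have : (K₁ / j + A₁ - Real.log (birkZ φ q j) / j) * j =
      K₁ + j * A₁ - Real.log (birkZ φ q j) := by field_simp
    linarith

lemma exists_oscillation_bound {f : ℝ → ℝ} (hf : ContinuousOn f (Icc 0 1)) (x : ℝ) :
    ∃ M : ℝ, ∀ z ∈ Icc (0 : ℝ) 1, |f z - f x| ≤ M := by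
  obtain ⟨M, hM⟩ := isCompact_Icc.exists_bound_of_continuousOn (hf.sub continuousOn_const
    : ContinuousOn (fun z => f z - f x) (Icc 0 1))
  exact ⟨M, hM⟩

lemma exists_closedBall_oscillation_le {γ θ : ℝ → ℝ} (hγc : ContinuousOn γ (Icc 0 1))
    (hθc : ContinuousOn θ (Icc 0 1)) {x : ℝ} (hx : x ∈ Ioo (0 : ℝ) 1) {η : ℝ} (hη : 0 < η) :
    ∃ r, 0 < r ∧ ∀ z ∈ closedBall x r, |γ z - γ x| ≤ η ∧ |θ z - θ x| ≤ η := by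
  have hIcc : Icc (0 : ℝ) 1 ∈ 𝓝 x := Icc_mem_nhds hx.1 hx.2
  have hev := ((hγc.continuousAt hIcc).eventually (Metric.closedBall_mem_nhds _ hη)).and
    ((hθc.continuousAt hIcc).eventually (Metric.closedBall_mem_nhds _ hη))
  obtain ⟨r, hr, hball⟩ := Metric.nhds_basis_closedBall.eventually_iff.1 hev
  exact ⟨r, hr, fun z hz => hball hz⟩

/-- The local scaling function is expressed through the pressure. -/
lemma birkLocScalingFn_eq {φ γ θ : ℝ → ℝ} {B C : ℝ} (hB : ∀ x, |φ x| ≤ B)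
    (h : BoundedDistortion φ C) (hper : ∀ x, φ (x + 1) = φ x)
    (hγc : ContinuousOn γ (Icc 0 1)) (hγpos : ∀ t ∈ Icc (0 : ℝ) 1, 0 < γ t)
    (hθc : ContinuousOn θ (Icc 0 1)) {x : ℝ} (hx : x ∈ Ioo (0 : ℝ) 1) {p P : ℝ}
    (hP : Tendsto (fun j : ℕ => Real.log (birkZ φ (-p * γ x) j) / j) atTop (𝓝 P)) :
    birkLocScalingFn φ γ θ x p = (p * θ x - P) / Real.log 2 := by
  have hl2 : 0 < Real.log 2 := Real.log_pos (by norm_num)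
  have hB0 : 0 ≤ B := (abs_nonneg _).trans (hB 0)
  have hc := (hγpos x (Ioo_subset_Icc_self hx)).le
  obtain ⟨M₁, hM₁⟩ := exists_oscillation_bound hγc x
  obtain ⟨M₂, hM₂⟩ := exists_oscillation_bound hθc x
  have hupper : ∀ r : ℝ, 0 < r → birkScalingFn φ γ θ (ball x r ∩ Ioo 0 1) p ≤
      (p * θ x - P) / Real.log 2 := by
    intro r hr
    -- for each oscillation bound `η` the error is at most `|p| η (B + 1)`
    have hη : ∀ η > 0, birkScalingFn φ γ θ (ball x r ∩ Ioo 0 1) p ≤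
        (|p| * (η * (B + 1)) + p * θ x - P) / Real.log 2 := by
      intro η hη
      obtain ⟨r₀, hr₀, hosc⟩ := exists_closedBall_oscillation_le hγc hθc hx hη
      obtain ⟨i, a, ha, hsub⟩ := exists_dyadicIntCl_subset hx (lt_min hr hr₀)
      have hs₀ : dyadicIntCl i (a : ℤ) ⊆ closedBall x r₀ := fun z hz =>
        ball_subset_closedBall (ball_subset_ball (min_le_right _ _) (hsub hz).1)
      have hs : dyadicIntCl i (a : ℤ) ⊆ ball x r ∩ Ioo 0 1 := fun z hz =>
        ⟨ball_subset_ball (min_le_left _ _) (hsub hz).1, (hsub hz).2⟩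
      obtain ⟨K, hK⟩ := le_birkStructFn (θ := θ) hB h hper hc ha inter_subset_right hs
        (fun z hz => (hosc z (hs₀ hz)).1) (fun z hz => (hosc z (hs₀ hz)).2) p
      exact (birkScalingFn_bounds hP hK (Eventually.of_forall fun j =>
        birkStructFn_le (η := max M₁ M₂) hB h hc (fun z hz => (hM₁ z hz.1).trans (le_max_left _ _))
          (fun z hz => (hM₂ z hz.1).trans (le_max_right _ _)) p j)).2
    have hlim : Tendsto (fun η : ℝ => (|p| * (η * (B + 1)) + p * θ x - P) / Real.log 2)
        (𝓝[>] 0) (𝓝 ((p * θ x - P) / Real.log 2)) := by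
      have hcont : Continuous fun η : ℝ => (|p| * (η * (B + 1)) + p * θ x - P) / Real.log 2 := by
        fun_prop
      have := (hcont.tendsto 0).mono_left (nhdsWithin_le_nhds (s := Ioi 0))
      simpa using this
    exact ge_of_tendsto hlim (eventually_mem_nhdsWithin.mono fun η hη' => hη η hη')
  have : Nonempty {r : ℝ // 0 < r} := ⟨⟨1, one_pos⟩⟩
  refine ciSup_eq_of_forall_le_of_forall_lt_exists_gt (fun r => hupper r.1 r.2) fun w hw => ?_
  have hlim : Tendsto (fun η : ℝ => -(|p| * (η * (B + 1)) - p * θ x + P) / Real.log 2)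
      (𝓝[>] 0) (𝓝 ((p * θ x - P) / Real.log 2)) := by
    have hcont : Continuous fun η : ℝ => -(|p| * (η * (B + 1)) - p * θ x + P) / Real.log 2 := by
      fun_prop
    have := (hcont.tendsto 0).mono_left (nhdsWithin_le_nhds (s := Ioi 0))
    have he : -(|p| * (0 * (B + 1)) - p * θ x + P) / Real.log 2 = (p * θ x - P) / Real.log 2 := by
      ring
    rwa [he] at this
  obtain ⟨η, hwη, hη⟩ := ((hlim.eventually_const_lt hw).and eventually_mem_nhdsWithin).exists
  obtain ⟨r, hr, hosc⟩ := exists_closedBall_oscillation_le hγc hθc hx hη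
  refine ⟨⟨r, hr⟩, hwη.trans_le ?_⟩
  obtain ⟨i, a, ha, hsub⟩ := exists_dyadicIntCl_subset hx hr
  have hs : dyadicIntCl i (a : ℤ) ⊆ closedBall x r := fun z hz =>
    ball_subset_closedBall (hsub hz).1
  obtain ⟨K, hK⟩ := le_birkStructFn (θ := θ) hB h hper hc ha inter_subset_right hsub
    (fun z hz => (hosc z (hs hz)).1) (fun z hz => (hosc z (hs hz)).2) p
  exact (birkScalingFn_bounds hP hK (Eventually.of_forall fun j =>
    birkStructFn_le hB h hc (fun z hz => (hosc z hz.2).1)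
      (fun z hz => (hosc z hz.2).2) p j)).1

/-! ### Counting dyadic intervals with prescribed Birkhoff average -/

lemma exists_mul_exp_neg_lt {f : ℝ → ℝ} {q ε : ℝ} (hd : HasDerivAt f 0 q) (hq : 0 < f q)
    (hε : 0 < ε) : ∃ η > 0, f (q + η) * Real.exp (-(η * ε)) < f q := by
  have h1 : HasDerivAt (fun η : ℝ => f (q + η)) 0 0 :=
    HasDerivAt.comp_const_add q 0 (by simpa using hd)
  have h2 : HasDerivAt (fun η : ℝ => Real.exp (-(η * ε))) (Real.exp (-(0 * ε)) * -(1 * ε)) 0 :=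
    (((hasDerivAt_id (0 : ℝ)).mul_const ε).neg).exp
  have h3 := (h1.mul h2).tendsto_slope_zero_right
  have hneg : 0 * Real.exp (-(0 * ε)) + f (q + 0) * (Real.exp (-(0 * ε)) * -(1 * ε)) < 0 := by
    simp only [zero_mul, neg_zero, Real.exp_zero, add_zero, one_mul, zero_add]
    nlinarith
  obtain ⟨η, hη, hη0⟩ := ((h3.eventually_lt_const hneg).and self_mem_nhdsWithin).exists
  have hη0 : 0 < η := hη0
  refine ⟨η, hη0, ?_⟩
  simp only [Pi.mul_apply, zero_add, add_zero, zero_mul, neg_zero, Real.exp_zero, mul_one,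
    smul_eq_mul] at hη
  have := (mul_neg_iff.1 hη).resolve_right (fun h => absurd h.1 (by positivity |> not_lt.2))
  linarith [this.2]

lemma eventually_sum_filter_le {K : ℕ → Finset ℕ} {A : ℕ → ℕ → ℝ} {f : ℝ → ℝ}
    (hf : ∀ q n, ∑ k ∈ K n, Real.exp (q * A n k) = f q ^ n) {q ε : ℝ}
    (hd : HasDerivAt f 0 q) (hq : 0 < f q) (hpos : ∀ q, 0 < f q) (hε : 0 < ε) :
    ∀ᶠ n : ℕ in atTop,
      ∑ k ∈ (K n).filter (fun k => n * ε < A n k), Real.exp (q * A n k) ≤ 1 / 4 * f q ^ n := by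
  obtain ⟨η, hη, hlt⟩ := exists_mul_exp_neg_lt hd hq hε
  set ρ := f (q + η) * Real.exp (-(η * ε)) / f q with hρ
  have hρ0 : 0 ≤ ρ := div_nonneg (mul_nonneg (hpos _).le (Real.exp_pos _).le) hq.le
  have hρ1 : ρ < 1 := (div_lt_one hq).2 hlt
  filter_upwards [(tendsto_pow_atTop_nhds_zero_of_lt_one hρ0 hρ1).eventually_lt_const
    (show (0 : ℝ) < 1 / 4 by norm_num)] with n hn
  calc ∑ k ∈ (K n).filter (fun k => n * ε < A n k), Real.exp (q * A n k)
      ≤ ∑ k ∈ (K n).filter (fun k => n * ε < A n k),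
          Real.exp (-(η * ε)) ^ n * Real.exp ((q + η) * A n k) := by
        refine Finset.sum_le_sum fun k hk => ?_
        rw [Finset.mem_filter] at hk
        rw [← Real.exp_nat_mul, ← Real.exp_add]
        refine Real.exp_le_exp.2 ?_
        nlinarith [mul_lt_mul_of_pos_left hk.2 hη]
    _ ≤ ∑ k ∈ K n, Real.exp (-(η * ε)) ^ n * Real.exp ((q + η) * A n k) :=
        Finset.sum_le_sum_of_subset_of_nonneg (Finset.filter_subset _ _)
          fun _ _ _ => by positivity
    _ = ρ ^ n * f q ^ n := by
        rw [← Finset.mul_sum, hf, ← mul_pow, ← mul_pow, hρ, div_mul_cancel₀ _ hq.ne', mul_comm]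
    _ ≤ 1 / 4 * f q ^ n := mul_le_mul_of_nonneg_right hn.le (pow_pos hq n).le

/-- If the exponential sums of `A n` are the powers of `f` and `q` is critical for `f`, then most
of the mass of the exponential sum at `q` comes from terms with `A n k = o(n)`. -/
lemma eventually_le_card_filter {K : ℕ → Finset ℕ} {A : ℕ → ℕ → ℝ} {f : ℝ → ℝ}
    (hf : ∀ q n, ∑ k ∈ K n, Real.exp (q * A n k) = f q ^ n) {q ε : ℝ}
    (hd : HasDerivAt f 0 q) (hpos : ∀ q, 0 < f q) (hε : 0 < ε) :
    ∀ᶠ n : ℕ in atTop, 1 / 2 * f q ^ n * Real.exp (-(|q| * (n * ε))) ≤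
      ((K n).filter (fun k => |A n k| ≤ n * ε)).card := by
  have hd' : HasDerivAt (fun q => f (-q)) 0 (-q) := by
    exact (HasDerivAt.scomp (-q) (g₁ := f) (g₁' := 0) (by simpa using hd)
      (hasDerivAt_neg (-q))).congr_deriv (by simp)
  have h1 := eventually_sum_filter_le hf hd (hpos q) hpos hε
  have h2 := eventually_sum_filter_le (A := fun n k => -A n k) (f := fun q => f (-q))
    (fun q n => by simpa using hf (-q) n) hd' (hpos _) (fun q => hpos _) hε
  filter_upwards [h1, h2] with n h1 h2
  simp only [neg_mul_neg, neg_neg] at h2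
  have hsplit : f q ^ n ≤ ∑ k ∈ (K n).filter (fun k => |A n k| ≤ n * ε), Real.exp (q * A n k) +
      (∑ k ∈ (K n).filter (fun k => n * ε < A n k), Real.exp (q * A n k) +
        ∑ k ∈ (K n).filter (fun k => n * ε < -A n k), Real.exp (q * A n k)) := by
    rw [← hf]
    simp only [Finset.sum_filter]
    rw [← Finset.sum_add_distrib, ← Finset.sum_add_distrib]
    refine Finset.sum_le_sum fun k _ => ?_
    have hE := (Real.exp_pos (q * A n k)).le
    by_cases h : |A n k| ≤ n * ε
    · rw [if_pos h]
      have : 0 ≤ (if n * ε < A n k then Real.exp (q * A n k) else 0) +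
        (if n * ε < -A n k then Real.exp (q * A n k) else 0) := by positivity
      linarith
    · rcases lt_abs.1 (not_le.1 h) with h' | h'
      · rw [if_neg h, if_pos h', zero_add]
        have : 0 ≤ (if n * ε < -A n k then Real.exp (q * A n k) else 0) := by positivity
        linarith
      · rw [if_neg h, if_pos h', zero_add]
        have : 0 ≤ (if n * ε < A n k then Real.exp (q * A n k) else 0) := by positivity
        linarith
  have hcard : ∑ k ∈ (K n).filter (fun k => |A n k| ≤ n * ε), Real.exp (q * A n k) ≤
      ((K n).filter (fun k => |A n k| ≤ n * ε)).card * Real.exp (|q| * (n * ε)) := by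
    refine (Finset.sum_le_card_nsmul _ _ _ fun k hk => Real.exp_le_exp.2 ?_).trans_eq
      (nsmul_eq_mul _ _)
    rw [Finset.mem_filter] at hk
    calc q * A n k ≤ |q * A n k| := le_abs_self _
      _ = |q| * |A n k| := abs_mul _ _
      _ ≤ _ := mul_le_mul_of_nonneg_left hk.2 (abs_nonneg q)
  rw [Real.exp_neg, ← div_eq_mul_inv, div_le_iff₀ (Real.exp_pos _)]
  linarith

/-- The sum of `a` over the `n` last digits of `k` in base `N`. -/
def digitSum (a : ℕ → ℝ) (N : ℕ) : ℕ → ℕ → ℝ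
  | 0, _ => 0
  | n + 1, k => digitSum a N n (k / N) + a (k % N)

lemma sum_exp_digitSum (a : ℕ → ℝ) (m : ℕ) (q : ℝ) (n : ℕ) :
    ∑ k ∈ Finset.range (2 ^ (m * n)), Real.exp (q * digitSum a (2 ^ m) n k) =
      (∑ b ∈ Finset.range (2 ^ m), Real.exp (q * a b)) ^ n := by
  induction n with
  | zero => simp [digitSum]
  | succ n ih =>
    rw [Nat.mul_succ, sum_range_two_pow_add, pow_succ, ← ih, Finset.sum_mul_sum]
    refine Finset.sum_congr rfl fun k _ => Finset.sum_congr rfl fun b hb => ?_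
    rw [Finset.mem_range] at hb
    rw [digitSum, Nat.mul_add_div (by positivity), Nat.div_eq_of_lt hb, add_zero,
      Nat.mul_add_mod, Nat.mod_eq_of_lt hb, mul_add, Real.exp_add]

lemma abs_birkSum_sub_digitSum_le {φ : ℝ → ℝ} {C : ℝ} (h : BoundedDistortion φ C)
    (hper : ∀ x, φ (x + 1) = φ x) (m : ℕ) (c : ℝ) (n k : ℕ) :
    |birkSum φ (m * n) (dyadicPt (m * n) k) - n * c -
      digitSum (fun b => birkSum φ m (dyadicPt m b) - c) (2 ^ m) n k| ≤ n * C := by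
  induction n generalizing k with
  | zero => simp [digitSum, birkSum]
  | succ n ih =>
    have h1 := ih (k / 2 ^ m)
    have h2 := abs_birkSum_concat_le h hper (m * n) m (k / 2 ^ m)
      (Nat.mod_lt k (show 0 < 2 ^ m by positivity))
    rw [Nat.div_add_mod] at h2
    rw [Nat.mul_succ, digitSum]
    push_cast
    rw [abs_le] at h1 h2 ⊢
    constructor <;> linarith [h1.1, h1.2, h2.1, h2.2]

lemma eventually_exp_le_card_birkSum {φ : ℝ → ℝ} {C : ℝ} (h : BoundedDistortion φ C)
    (hper : ∀ x, φ (x + 1) = φ x) {Pr : ℝ → ℝ}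
    (hP : ∀ q, Tendsto (fun j : ℕ => Real.log (birkZ φ q j) / j) atTop (𝓝 (Pr q)))
    {β σ δ : ℝ} (hδ : 0 < δ) (hlow : ∀ q, σ + 2 * δ * |q| ≤ Pr q - q * β) {m : ℕ} (hm : 0 < m)
    (hC : C ≤ m * δ) :
    ∀ᶠ n : ℕ in atTop, 1 / 2 * Real.exp (n * (m * σ)) ≤
      ((Finset.range (2 ^ (m * n))).filter (fun k =>
        |birkSum φ (m * n) (dyadicPt (m * n) k) - n * (m * β)| ≤ n * (2 * (m * δ)))).card := by
  have hm0 : (0 : ℝ) < m := by exact_mod_cast hm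
  set a : ℕ → ℝ := fun b => birkSum φ m (dyadicPt m b) - m * β with ha
  set f : ℝ → ℝ := fun q => ∑ b ∈ Finset.range (2 ^ m), Real.exp (q * a b) with hf
  have hfZ : ∀ q, f q = birkZ φ q m * Real.exp (-(q * (m * β))) := fun q => by
    simp only [hf, birkZ, Finset.sum_mul, ha, ← Real.exp_add]
    refine Finset.sum_congr rfl fun b _ => ?_
    ring_nf
  have hpos : ∀ q, 0 < f q := fun q => by
    rw [hfZ]; exact mul_pos (birkZ_pos _ _ _) (Real.exp_pos _)
  have hflow : ∀ q, Real.exp (m * (σ + δ * |q|)) ≤ f q := fun q => by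
    rw [hfZ, ← Real.exp_log (birkZ_pos φ q m), ← Real.exp_add]
    refine Real.exp_le_exp.2 ?_
    have h1 := mul_pressure_le h hper (hP q) hm
    have h2 := mul_le_mul_of_nonneg_left (hlow q) hm0.le
    have h3 := mul_le_mul_of_nonneg_left hC (abs_nonneg q)
    linarith
  have hcont : Continuous f := by fun_prop
  have hcoer : Tendsto f (cocompact ℝ) atTop := by
    refine tendsto_atTop_mono hflow (Real.tendsto_exp_atTop.comp ?_)
    exact (tendsto_atTop_add_const_left _ _
      ((tendsto_norm_cocompact_atTop (E := ℝ)).const_mul_atTop hδ)).const_mul_atTop hm0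
  obtain ⟨q, hq⟩ := hcont.exists_forall_le hcoer
  have hdiff : Differentiable ℝ f := by fun_prop
  have hd : HasDerivAt f 0 q := by
    have := (hdiff q).hasDerivAt
    rwa [IsLocalMin.deriv_eq_zero (Eventually.of_forall hq)] at this
  have hcount := eventually_le_card_filter (K := fun n => Finset.range (2 ^ (m * n)))
    (A := digitSum a (2 ^ m)) (f := f) (fun q n => sum_exp_digitSum a m q n) hd hpos
    (mul_pos hm0 hδ)
  filter_upwards [hcount] with n hn
  refine le_trans ?_ (hn.trans (Nat.cast_le.2 (Finset.card_le_card ?_)))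
  · rw [mul_assoc]
    refine mul_le_mul_of_nonneg_left ?_ (by norm_num)
    have h1 := pow_le_pow_left₀ (Real.exp_pos _).le (hflow q) n
    refine le_trans ?_ (mul_le_mul_of_nonneg_right h1 (Real.exp_pos _).le)
    rw [← Real.exp_nat_mul, ← Real.exp_add]
    refine Real.exp_le_exp.2 (le_of_eq ?_)
    ring
  · intro k hk
    rw [Finset.mem_filter] at hk ⊢
    refine ⟨hk.1, ?_⟩
    have h1 := abs_birkSum_sub_digitSum_le h hper m (m * β) n k
    have h2 := hk.2
    have h3 := mul_le_mul_of_nonneg_left hC (Nat.cast_nonneg (α := ℝ) n)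
    rw [abs_le] at h1 h2 ⊢
    constructor <;> linarith [h1.1, h1.2, h2.1, h2.2]

/-- A lower bound on the Legendre transform at an interior point improves to a coercive one. -/
lemma exists_coercive_lower_bound {Pr : ℝ → ℝ} {Am Ap β σ σ' : ℝ}
    (hp : ∀ q, 0 ≤ q → q * Ap ≤ Pr q) (hm : ∀ q, q ≤ 0 → q * Am ≤ Pr q)
    (hβ : β ∈ Ioo Am Ap) (hσ : σ < σ') (hlow : ∀ q, σ' ≤ Pr q - q * β) :
    ∃ δ₀ > 0, ∀ δ, 0 ≤ δ → δ ≤ δ₀ → ∀ q, σ + δ * |q| ≤ Pr q - q * β := by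
  set d := min (Ap - β) (β - Am) with hd
  have hd0 : 0 < d := lt_min (by linarith [hβ.2]) (by linarith [hβ.1])
  have hdq : ∀ q, d * |q| ≤ Pr q - q * β := fun q => by
    rcases le_total 0 q with h | h
    · rw [abs_of_nonneg h]
      nlinarith [hp q h, min_le_left (Ap - β) (β - Am)]
    · rw [abs_of_nonpos h]
      nlinarith [hm q h, min_le_right (Ap - β) (β - Am)]
  -- interpolate between the constant and the coercive lower bounds
  obtain ⟨t, ht0, ht1, ht⟩ : ∃ t : ℝ, 0 < t ∧ t ≤ 1 ∧ σ ≤ (1 - t) * σ' := by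
    have hM : 0 < |σ'| + 1 := by positivity
    refine ⟨min 1 ((σ' - σ) / (|σ'| + 1)), lt_min one_pos (div_pos (by linarith) hM),
      min_le_left _ _, ?_⟩
    have h1 : min 1 ((σ' - σ) / (|σ'| + 1)) * (|σ'| + 1) ≤ σ' - σ :=
      (le_div_iff₀ hM).1 (min_le_right _ _)
    have h2 : 0 < min 1 ((σ' - σ) / (|σ'| + 1)) := lt_min one_pos (div_pos (by linarith) hM)
    nlinarith [le_abs_self σ']
  refine ⟨t * d, mul_pos ht0 hd0, fun δ hδ0 hδ q => ?_⟩
  have h1 := mul_le_mul_of_nonneg_right hδ (abs_nonneg q)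
  nlinarith [hdq q, hlow q, abs_nonneg q]

lemma exists_strictMonoOn_of_le_card {s : Finset ℕ} {N : ℕ} (hN : N ≤ s.card) :
    ∃ w : ℕ → ℕ, StrictMonoOn w (Iio N) ∧ ∀ c < N, w c ∈ s := by
  refine ⟨fun c => if hc : c < N then s.orderEmbOfCardLe hN ⟨c, hc⟩ else 0, ?_, ?_⟩
  · intro c hc d hd hcd
    simp only [dif_pos (mem_Iio.1 hc), dif_pos (mem_Iio.1 hd)]
    exact (s.orderEmbOfCardLe hN).strictMono hcd
  · intro c hc
    simp only [dif_pos hc]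
    exact s.orderEmbOfCardLe_mem hN _

/-- Two families of at least `2 ^ (s L)` dyadic words of length `L`, with Birkhoff averages
respectively above and below `β`. -/
lemma exists_words {φ : ℝ → ℝ} {C : ℝ} (h : BoundedDistortion φ C)
    (hper : ∀ x, φ (x + 1) = φ x) {Pr : ℝ → ℝ}
    (hP : ∀ q, Tendsto (fun j : ℕ => Real.log (birkZ φ q j) / j) atTop (𝓝 (Pr q)))
    {Am Ap β s σ : ℝ}
    (hp : ∀ q, 0 ≤ q → q * Ap ≤ Pr q) (hm : ∀ q, q ≤ 0 → q * Am ≤ Pr q)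
    (hβ : β ∈ Ioo Am Ap) (hs : 0 < s) (hsσ : s * Real.log 2 < σ)
    (hlow : ∀ q, σ ≤ Pr q - q * β) :
    ∃ (δ : ℝ) (L b : ℕ) (w₁ w₂ : ℕ → ℕ), 0 < δ ∧ 0 < L ∧ 0 < b ∧ s * L ≤ b ∧
      C ≤ L * (δ / 2) ∧ StrictMonoOn w₁ (Iio (2 ^ b)) ∧ StrictMonoOn w₂ (Iio (2 ^ b)) ∧
      (∀ c < 2 ^ b, w₁ c < 2 ^ L ∧ L * (β + δ) ≤ birkSum φ L (dyadicPt L (w₁ c))) ∧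
      (∀ c < 2 ^ b, w₂ c < 2 ^ L ∧ birkSum φ L (dyadicPt L (w₂ c)) ≤ L * (β - δ)) := by
  obtain ⟨σ₁, hσ₁, hσ₁'⟩ := exists_between hsσ
  obtain ⟨δ₀, hδ₀, hco⟩ := exists_coercive_lower_bound hp hm hβ hσ₁' hlow
  set δ := δ₀ / 5 with hδ
  have hδ0 : 0 < δ := by positivity
  obtain ⟨m₀, hm₀⟩ := exists_nat_ge (C / δ)
  set m := m₀ + 1
  have hm0 : 0 < m := Nat.succ_pos _
  have hmr : (0 : ℝ) < m := by exact_mod_cast hm0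
  have hC : C ≤ m * δ := by
    rw [div_le_iff₀ hδ0] at hm₀
    refine hm₀.trans (mul_le_mul_of_nonneg_right ?_ hδ0.le)
    exact_mod_cast Nat.le_succ m₀
  have hc := hco (5 * δ) (by positivity) (by rw [hδ]; linarith)
  have hlow₁ : ∀ q, σ₁ + 2 * δ * |q| ≤ Pr q - q * (β + 3 * δ) := fun q => by
    have := mul_le_mul_of_nonneg_left (le_abs_self q) hδ0.le
    have := hc q
    linarith
  have hlow₂ : ∀ q, σ₁ + 2 * δ * |q| ≤ Pr q - q * (β - 3 * δ) := fun q => by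
    have := mul_le_mul_of_nonneg_left (neg_abs_le q) hδ0.le
    have := hc q
    linarith
  have hgrow : Tendsto (fun n : ℕ => (n : ℝ) * (m * (σ₁ - s * Real.log 2))) atTop atTop :=
    tendsto_natCast_atTop_atTop.atTop_mul_const (mul_pos hmr (by linarith))
  obtain ⟨n, hn₁, hn₂, hn₃, hn₄⟩ := ((eventually_exp_le_card_birkSum h hper hP hδ0 hlow₁ hm0 hC).and
    ((eventually_exp_le_card_birkSum h hper hP hδ0 hlow₂ hm0 hC).and
      ((hgrow.eventually_ge_atTop (Real.log 4)).and (eventually_ge_atTop 2)))).exists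
  have hn0 : (2 : ℝ) ≤ n := by exact_mod_cast hn₄
  set b := ⌈s * ((m * n : ℕ) : ℝ)⌉₊ with hb
  have hL0 : 0 < m * n := Nat.mul_pos hm0 (by omega)
  have hLr : (0 : ℝ) < ((m * n : ℕ) : ℝ) := by exact_mod_cast hL0
  have hbpos : 0 < b := Nat.ceil_pos.2 (mul_pos hs hLr)
  have hble : (b : ℝ) ≤ s * ((m * n : ℕ) : ℝ) + 1 := (Nat.ceil_lt_add_one (by positivity)).le
  have hnum : ((2 ^ b : ℕ) : ℝ) ≤ 1 / 2 * Real.exp (n * (m * σ₁)) := by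
    have h2 : ((2 ^ b : ℕ) : ℝ) = Real.exp (b * Real.log 2) := by
      rw [Real.exp_nat_mul, Real.exp_log (by norm_num)]; push_cast; rfl
    have h4 : Real.log 4 = 2 * Real.log 2 := by
      rw [show (4 : ℝ) = 2 ^ 2 by norm_num, Real.log_pow]; norm_num
    have h5 : (1 / 2 : ℝ) = Real.exp (-Real.log 2) := by
      rw [Real.exp_neg, Real.exp_log (by norm_num)]; norm_num
    rw [h2, h5, ← Real.exp_add]
    refine Real.exp_le_exp.2 ?_
    have h6 := mul_le_mul_of_nonneg_right hble (Real.log_nonneg (show (1 : ℝ) ≤ 2 by norm_num))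
    push_cast at h6
    linarith
  obtain ⟨w₁, hw₁, hw₁'⟩ := exists_strictMonoOn_of_le_card (Nat.cast_le.1 (hnum.trans hn₁))
  obtain ⟨w₂, hw₂, hw₂'⟩ := exists_strictMonoOn_of_le_card (Nat.cast_le.1 (hnum.trans hn₂))
  refine ⟨δ, m * n, b, w₁, w₂, hδ0, hL0, hbpos, Nat.le_ceil _, ?_, hw₁, hw₂,
    fun c hc => ?_, fun c hc => ?_⟩
  · push_cast
    nlinarith [mul_pos hmr hδ0]
  · have := hw₁' c hc
    rw [Finset.mem_filter, Finset.mem_range, abs_le] at this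
    refine ⟨this.1, ?_⟩
    push_cast
    linarith [this.2.1]
  · have := hw₂' c hc
    rw [Finset.mem_filter, Finset.mem_range, abs_le] at this
    refine ⟨this.1, ?_⟩
    push_cast
    linarith [this.2.2]

/-! ### Cantor sets driven by a digit rule -/

/-- The index of the `n`-th generation interval with address `i` in base `2 ^ b`, for the rule
`w` choosing `2 ^ b` sons of each interval `L` scales below. -/
def cantorIdx (L b k₀ : ℕ) (w : ℕ → ℕ → ℕ → ℕ) : ℕ → ℕ → ℕ
  | 0, _ => k₀
  | n + 1, i => 2 ^ L * cantorIdx L b k₀ w n (i / 2 ^ b) +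
      w n (cantorIdx L b k₀ w n (i / 2 ^ b)) (i % 2 ^ b)

section Cantor

variable {L b k₀ : ℕ} {w : ℕ → ℕ → ℕ → ℕ}

lemma strictMonoOn_cantorIdx (hw : ∀ n k, StrictMonoOn (w n k) (Iio (2 ^ b)))
    (hwL : ∀ n k, ∀ c < 2 ^ b, w n k c < 2 ^ L) (n : ℕ) :
    StrictMonoOn (cantorIdx L b k₀ w n) (Iio (2 ^ (b * n))) := by
  have hpos : 0 < 2 ^ b := by positivity
  induction n with
  | zero =>
    intro i hi j hj hij
    simp only [mul_zero, pow_zero, mem_Iio] at hi hj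
    omega
  | succ n ih =>
    intro i hi j hj hij
    have hdiv : ∀ i ∈ Iio (2 ^ (b * (n + 1))), i / 2 ^ b ∈ Iio (2 ^ (b * n)) := fun i hi => by
      rw [mem_Iio, Nat.div_lt_iff_lt_mul hpos, ← pow_add, ← Nat.mul_succ]
      exact hi
    simp only [cantorIdx]
    rcases (Nat.div_le_div_right (c := 2 ^ b) hij.le).lt_or_eq with hlt | heq
    · have h1 := ih (hdiv i hi) (hdiv j hj) hlt
      have h2 := hwL n (cantorIdx L b k₀ w n (i / 2 ^ b)) _ (Nat.mod_lt i hpos)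
      have h3 := Nat.mul_le_mul_left (2 ^ L) (Nat.succ_le_of_lt h1)
      rw [Nat.mul_succ] at h3
      omega
    · rw [← heq]
      refine Nat.add_lt_add_left (hw _ _ (Nat.mod_lt i hpos) (Nat.mod_lt j hpos) ?_) _
      have h1 := Nat.div_add_mod i (2 ^ b)
      have h2 := Nat.div_add_mod j (2 ^ b)
      rw [← heq] at h2
      omega

lemma floor_two_pow_mul_div (b n : ℕ) (t : ℝ) :
    ⌊(2 : ℝ) ^ (b * (n + 1)) * t⌋₊ / 2 ^ b = ⌊(2 : ℝ) ^ (b * n) * t⌋₊ := by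
  rw [← Nat.floor_div_natCast]
  congr 1
  rw [Nat.mul_succ, pow_add]
  push_cast
  field_simp

lemma floor_two_pow_mul_lt {t : ℝ} (ht : t ∈ Ico (0 : ℝ) 1) (m : ℕ) :
    ⌊(2 : ℝ) ^ m * t⌋₊ < 2 ^ m := by
  rw [Nat.floor_lt (mul_nonneg (by positivity) ht.1)]
  push_cast
  have : (0 : ℝ) < 2 ^ m := by positivity
  nlinarith [ht.2]

lemma exists_mem_dyadicIntCl_cantorIdx (hwL : ∀ n k, ∀ c < 2 ^ b, w n k c < 2 ^ L) (j₀ : ℕ)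
    (t : ℝ) :
    ∃ y, ∀ n, y ∈ dyadicIntCl (j₀ + n * L)
      ((cantorIdx L b k₀ w n ⌊(2 : ℝ) ^ (b * n) * t⌋₊ : ℕ) : ℤ) := by
  have := IsCompact.nonempty_iInter_of_sequence_nonempty_isCompact_isClosed
    (fun n => dyadicIntCl (j₀ + n * L)
      ((cantorIdx L b k₀ w n ⌊(2 : ℝ) ^ (b * n) * t⌋₊ : ℕ) : ℤ)) (fun n => ?_)
    (fun n => ⟨_, dyadicPt_mem_dyadicIntCl _ _⟩) isCompact_Icc (fun n => isClosed_Icc)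
  · obtain ⟨y, hy⟩ := this
    exact ⟨y, fun n => mem_iInter.1 hy n⟩
  · rw [cantorIdx, floor_two_pow_mul_div, Nat.succ_mul, ← add_assoc]
    exact dyadicIntCl_concat_subset _ _ _ (hwL _ _ _ (Nat.mod_lt _ (by positivity)))

end Cantor

/-- A map which does not contract distances by more than a power `r` has an image of dimension at
least `r` times that of its source. -/
lemma mul_dimH_le_dimH_image {G : ℝ → ℝ} {S : Set ℝ} {K r : NNReal} (hr : 0 < r)
    (hG : ∀ t ∈ S, ∀ u ∈ S, edist t u ≤ K * edist (G t) (G u) ^ (r : ℝ)) :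
    r * dimH S ≤ dimH (G '' S) := by
  have hinj : InjOn G S := fun t ht u hu htu => by
    have := hG t ht u hu
    rw [htu, edist_self, ENNReal.zero_rpow_of_pos (by exact_mod_cast hr), mul_zero] at this
    exact edist_le_zero.1 this
  have hinv := hinj.leftInvOn_invFunOn
  have hF : HolderOnWith K r (Function.invFunOn G S) (G '' S) := by
    rintro _ ⟨t, ht, rfl⟩ _ ⟨u, hu, rfl⟩
    rw [hinv ht, hinv hu]
    exact hG t ht u hu
  have := hF.dimH_image_le hr
  rw [hinv.image_image] at this
  rwa [ENNReal.le_div_iff_mul_le (by simp [hr.ne']) (by simp), mul_comm] at this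

lemma dimH_Ico_zero_one : dimH (Ico (0 : ℝ) 1) = 1 :=
  by
  rw [Real.dimH_of_nonempty_interior ⟨(1 / 2 : ℝ), by rw [interior_Ico]; norm_num⟩]
  simp

lemma exists_two_le_pow_mul {b : ℕ} (hb : 0 < b) {d : ℝ} (hd0 : 0 < d) (hd1 : d < 1) :
    ∃ n : ℕ, 2 ≤ (2 : ℝ) ^ (b * n) * d ∧ (2 : ℝ) ^ (b * n) * d ≤ 2 ^ b * 2 := by
  classical
  have hex : ∃ n : ℕ, 2 ≤ (2 : ℝ) ^ (b * n) * d := by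
    obtain ⟨n, hn⟩ := pow_unbounded_of_one_lt (2 / d) (one_lt_two (α := ℝ))
    refine ⟨n, ?_⟩
    rw [div_lt_iff₀ hd0] at hn
    refine hn.le.trans (mul_le_mul_of_nonneg_right ?_ hd0.le)
    exact pow_le_pow_right₀ one_le_two (Nat.le_mul_of_pos_left n hb)
  refine ⟨Nat.find hex, Nat.find_spec hex, ?_⟩
  rcases hn : Nat.find hex with _ | n
  · have := Nat.find_spec hex
    rw [hn] at this
    simp only [mul_zero, pow_zero, one_mul] at this
    linarith
  · have := Nat.find_min hex (show n < Nat.find hex by omega)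
    rw [not_le] at this
    rw [Nat.mul_succ, add_comm, pow_add, mul_assoc]
    exact mul_le_mul_of_nonneg_left this.le (by positivity)

/-- The points whose dyadic coding follows the rule `w` form a set of dimension at least
`b / L`. -/
lemma div_le_dimH_of_forall_mem {j₀ k₀ L b : ℕ} (hL : 0 < L) (hb : 0 < b)
    {w : ℕ → ℕ → ℕ → ℕ} (hw : ∀ n k, StrictMonoOn (w n k) (Iio (2 ^ b)))
    (hwL : ∀ n k, ∀ c < 2 ^ b, w n k c < 2 ^ L) {S : Set ℝ}
    (hS : ∀ (κ : ℕ → ℕ) (y : ℝ), κ 0 = k₀ →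
      (∀ n, ∃ c < 2 ^ b, κ (n + 1) = 2 ^ L * κ n + w n (κ n) c) →
      (∀ n, y ∈ dyadicIntCl (j₀ + n * L) (κ n : ℤ)) → y ∈ S) :
    ((b / L : NNReal) : ℝ≥0∞) ≤ dimH S := by
  choose G hG using exists_mem_dyadicIntCl_cantorIdx (k₀ := k₀) hwL j₀
  have hL0 : (0 : ℝ) < L := by exact_mod_cast hL
  have hb0 : (0 : ℝ) < b := by exact_mod_cast hb
  set r : ℝ := b / L with hr
  have hr0 : 0 < r := div_pos hb0 hL0
  set K : ℝ := 2 ^ b * 2 * (2 ^ j₀) ^ r with hK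
  have hsep : ∀ t ∈ Ico (0 : ℝ) 1, ∀ u ∈ Ico (0 : ℝ) 1, t < u → u - t ≤ K * |G u - G t| ^ r := by
    intro t ht u hu htu
    obtain ⟨n, hn1, hn2⟩ := exists_two_le_pow_mul hb (sub_pos.2 htu)
      (by linarith [hu.2, ht.1] : u - t < 1)
    have hfl : ⌊(2 : ℝ) ^ (b * n) * t⌋₊ + 2 ≤ ⌊(2 : ℝ) ^ (b * n) * u⌋₊ := by
      refine Nat.le_floor ?_
      push_cast
      have := Nat.floor_le (mul_nonneg (pow_nonneg zero_le_two (b * n)) ht.1)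
      linarith
    have hmono := strictMonoOn_cantorIdx (k₀ := k₀) hw hwL n
    have hu' := floor_two_pow_mul_lt hu (b * n)
    have h1 := hmono (show ⌊(2 : ℝ) ^ (b * n) * t⌋₊ ∈ Iio (2 ^ (b * n)) by rw [mem_Iio]; omega)
      (show ⌊(2 : ℝ) ^ (b * n) * t⌋₊ + 1 ∈ Iio (2 ^ (b * n)) by rw [mem_Iio]; omega)
      (Nat.lt_succ_self _)
    have h2 := hmono (show ⌊(2 : ℝ) ^ (b * n) * t⌋₊ + 1 ∈ Iio (2 ^ (b * n)) by rw [mem_Iio]; omega)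
      (show ⌊(2 : ℝ) ^ (b * n) * u⌋₊ ∈ Iio (2 ^ (b * n)) from hu')
      (by omega)
    have h3 := hG t n
    have h4 := hG u n
    rw [dyadicIntCl_natCast, dyadicPt] at h3 h4
    have h5 : ((cantorIdx L b k₀ w n ⌊(2 : ℝ) ^ (b * n) * t⌋₊ : ℕ) : ℝ) + 2 ≤
        (cantorIdx L b k₀ w n ⌊(2 : ℝ) ^ (b * n) * u⌋₊ : ℕ) := by
      exact_mod_cast (by omega : cantorIdx L b k₀ w n ⌊(2 : ℝ) ^ (b * n) * t⌋₊ + 2 ≤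
        cantorIdx L b k₀ w n ⌊(2 : ℝ) ^ (b * n) * u⌋₊)
    have hdist : ((2 : ℝ) ^ (j₀ + n * L))⁻¹ ≤ |G u - G t| := by
      refine le_trans ?_ (le_abs_self _)
      have h6 := div_le_div_of_nonneg_right h5 (pow_nonneg zero_le_two (j₀ + n * L) : (0 : ℝ) ≤ _)
      rw [add_div, div_eq_mul_inv (2 : ℝ)] at h6
      linarith [h3.2, h4.1]
    have hpow : (1 : ℝ) ≤ 2 ^ (b * n) * ((2 ^ j₀) ^ r * |G u - G t| ^ r) := by
      have h7 : (2 : ℝ) ^ (b * n) = ((2 : ℝ) ^ (n * L)) ^ r := by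
        rw [← Real.rpow_natCast, ← Real.rpow_natCast, ← Real.rpow_mul zero_le_two]
        congr 1
        push_cast
        rw [hr]; field_simp
      rw [h7, ← Real.mul_rpow (by positivity) (abs_nonneg _),
        ← Real.mul_rpow (by positivity) (by positivity)]
      refine Real.one_le_rpow ?_ hr0.le
      rw [← mul_assoc, ← pow_add, add_comm]
      rwa [inv_le_iff_one_le_mul₀' (by positivity)] at hdist
    have hu0 : 0 ≤ u - t := by linarith
    have h8 : (0 : ℝ) < 2 ^ (b * n) := by positivity
    have h9 : 0 ≤ (2 ^ j₀ : ℝ) ^ r * |G u - G t| ^ r := by positivity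
    calc u - t = 1 * (u - t) := (one_mul _).symm
      _ ≤ 2 ^ (b * n) * ((2 ^ j₀) ^ r * |G u - G t| ^ r) * (u - t) :=
          mul_le_mul_of_nonneg_right hpow hu0
      _ = 2 ^ (b * n) * (u - t) * ((2 ^ j₀) ^ r * |G u - G t| ^ r) := by ring
      _ ≤ 2 ^ b * 2 * ((2 ^ j₀) ^ r * |G u - G t| ^ r) := mul_le_mul_of_nonneg_right hn2 h9
      _ = K * |G u - G t| ^ r := by rw [hK]; ring
  have hK0 : 0 ≤ K := by positivity
  have hdist : ∀ t ∈ Ico (0 : ℝ) 1, ∀ u ∈ Ico (0 : ℝ) 1, dist t u ≤ K * dist (G t) (G u) ^ r := by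
    intro t ht u hu
    rcases lt_trichotomy t u with h | rfl | h
    · rw [dist_comm t, dist_comm (G t), Real.dist_eq, Real.dist_eq, abs_of_pos (sub_pos.2 h)]
      exact hsep t ht u hu h
    · rw [dist_self]; positivity
    · rw [Real.dist_eq, Real.dist_eq, abs_of_pos (sub_pos.2 h)]
      exact hsep u hu t ht h
  have hmain := mul_dimH_le_dimH_image (G := G) (S := Ico 0 1) (K := K.toNNReal)
    (r := (b / L : NNReal)) (by positivity) (fun t ht u hu => by
      rw [edist_dist, edist_dist]
      have : ((b / L : NNReal) : ℝ) = r := by push_cast; rfl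
      rw [this, ENNReal.ofReal_rpow_of_nonneg dist_nonneg hr0.le]
      change _ ≤ ENNReal.ofReal K * _
      rw [← ENNReal.ofReal_mul hK0]
      exact ENNReal.ofReal_le_ofReal (hdist t ht u hu))
  rw [dimH_Ico_zero_one, mul_one] at hmain
  refine hmain.trans (dimH_mono ?_)
  rintro _ ⟨t, _, rfl⟩
  refine hS (fun n => cantorIdx L b k₀ w n ⌊(2 : ℝ) ^ (b * n) * t⌋₊) (G t) rfl (fun n => ?_) (hG t)
  refine ⟨⌊(2 : ℝ) ^ (b * (n + 1)) * t⌋₊ % 2 ^ b, Nat.mod_lt _ (by positivity), ?_⟩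
  rw [cantorIdx, floor_two_pow_mul_div]

/-! ### Steering Birkhoff averages to a prescribed limit -/

lemma eventually_neg_mul_le_of_steering {D M : ℕ → ℝ} {R : ℝ} (hM : Monotone M)
    (hMt : Tendsto M atTop atTop) (hR : ∀ n, |D (n + 1) - D n| ≤ R)
    (hst : ∀ η > 0, ∀ᶠ n in atTop, D n < -(η * M n) → D n ≤ D (n + 1)) {ε : ℝ} (hε : 0 < ε) :
    ∀ᶠ n in atTop, -(ε * M n) ≤ D n := by
  have hη : 0 < ε / 2 := by positivity
  have hR0 : 0 ≤ R := (abs_nonneg _).trans (hR 0)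
  obtain ⟨n₀, hn₀⟩ := eventually_atTop.1 ((hst _ hη).and (hMt.eventually_ge_atTop 0))
  have hclaim : ∀ n ≥ n₀, -(ε / 2 * M n) - (R + |D n₀|) ≤ D n := by
    intro n hn
    induction n, hn using Nat.le_induction with
    | base =>
      have := mul_nonneg hη.le (hn₀ n₀ le_rfl).2
      linarith [neg_abs_le (D n₀)]
    | succ n hn ih =>
      have h1 := mul_le_mul_of_nonneg_left (hM (Nat.le_succ n)) hη.le
      by_cases hlt : D n < -(ε / 2 * M n)
      · have := (hn₀ n hn).1 hlt
        linarith
      · have := (abs_le.1 (hR n)).1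
        have := abs_nonneg (D n₀)
        linarith [not_lt.1 hlt]
  filter_upwards [eventually_ge_atTop n₀,
    (hMt.const_mul_atTop hη).eventually_ge_atTop (R + |D n₀|)] with n hn hn'
  linarith [hclaim n hn]

/-- The rule choosing between two families of words according to the position of the current
Birkhoff sum with respect to the target `g`. -/
def steeringRule (φ g : ℝ → ℝ) (j₀ L : ℕ) (w₁ w₂ : ℕ → ℕ) (n k c : ℕ) : ℕ :=
  open Classical in
  if birkSum φ (j₀ + n * L) (dyadicPt (j₀ + n * L) k) ≤
      ((j₀ + n * L : ℕ) : ℝ) * g (dyadicPt (j₀ + n * L) k)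
  then w₁ c else w₂ c

lemma tendsto_birkSum_div_of_bounded_gaps {φ : ℝ → ℝ} {B C : ℝ} (hB : ∀ x, |φ x| ≤ B)
    {j₀ L : ℕ} (hL : 0 < L) {X : ℕ → ℝ} {y a : ℝ}
    (hX : ∀ n, |birkSum φ (j₀ + n * L) y - X n| ≤ C)
    (hlim : ∀ ε > 0, ∀ᶠ n in atTop,
      |X n - ((j₀ + n * L : ℕ) : ℝ) * a| ≤ ε * ((j₀ + n * L : ℕ) : ℝ)) :
    Tendsto (fun j : ℕ => birkSum φ j y / j) atTop (𝓝 a) := by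
  have hB0 : 0 ≤ B := (abs_nonneg _).trans (hB 0)
  have hdiv : Tendsto (fun j : ℕ => (j - j₀) / L) atTop atTop :=
    (Nat.tendsto_div_const_atTop hL.ne').comp (tendsto_sub_atTop_nat j₀)
  rw [Metric.tendsto_atTop']
  intro ε hε
  have hE : ∀ᶠ j : ℕ in atTop, 2 * (C + L * B + L * |a|) / ε < j :=
    tendsto_natCast_atTop_atTop.eventually_gt_atTop _
  obtain ⟨N, hN⟩ := eventually_atTop.1
    ((hdiv.eventually (hlim (ε / 2) (by positivity))).and (hE.and (eventually_gt_atTop j₀)))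
  refine ⟨N, fun j hj => ?_⟩
  obtain ⟨h1, h2, h3⟩ := hN j hj.le
  have hj0 : (0 : ℝ) < j := by exact_mod_cast (Nat.zero_le _).trans_lt h3
  set n := (j - j₀) / L
  obtain ⟨r, hr, hjr⟩ : ∃ r ≤ L, j = j₀ + n * L + r := by
    refine ⟨(j - j₀) % L, (Nat.mod_lt _ hL).le, ?_⟩
    have : n * L + (j - j₀) % L = j - j₀ := Nat.div_add_mod' (j - j₀) L
    omega
  have h4 : |birkSum φ j y - birkSum φ (j₀ + n * L) y| ≤ L * B := by
    rw [hjr, birkSum_add, add_sub_cancel_left]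
    exact (abs_birkSum_le hB _ _).trans
      (mul_le_mul_of_nonneg_right (by exact_mod_cast hr) hB0)
  have hjr' : (j : ℝ) = ((j₀ + n * L : ℕ) : ℝ) + r := by exact_mod_cast hjr
  have h5 : |(r : ℝ) * a| ≤ L * |a| := by
    rw [abs_mul, Nat.abs_cast]
    exact mul_le_mul_of_nonneg_right (by exact_mod_cast hr) (abs_nonneg a)
  have h6 : |birkSum φ j y - j * a| < ε * j := by
    have h7 : birkSum φ j y - j * a = (birkSum φ j y - birkSum φ (j₀ + n * L) y) +
        (birkSum φ (j₀ + n * L) y - X n) + (X n - ((j₀ + n * L : ℕ) : ℝ) * a) - r * a := by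
      rw [hjr']; ring
    have h8 : ε / 2 * ((j₀ + n * L : ℕ) : ℝ) ≤ ε / 2 * j := by
      refine mul_le_mul_of_nonneg_left ?_ (by positivity)
      rw [hjr']; linarith [Nat.cast_nonneg (α := ℝ) r]
    rw [div_lt_iff₀ hε] at h2
    have h9 := hX n
    rw [h7]
    rw [abs_le] at h1 h4 h5 h9
    rw [abs_lt]
    constructor <;>
      linarith [h1.1, h1.2, h4.1, h4.2, h5.1, h5.2, h9.1, h9.2]
  rw [Real.dist_eq, show birkSum φ j y / j - a = (birkSum φ j y - j * a) / j by field_simp,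
    abs_div, Nat.abs_cast, div_lt_iff₀ hj0]
  exact h6

lemma tendsto_birkSum_div_of_steeringRule {φ : ℝ → ℝ} {B C : ℝ} (hB : ∀ x, |φ x| ≤ B)
    (h : BoundedDistortion φ C) (hper : ∀ x, φ (x + 1) = φ x) {g : ℝ → ℝ}
    (hg : ContinuousOn g (Icc 0 1)) {β δ : ℝ} {j₀ k₀ L N : ℕ} {w₁ w₂ : ℕ → ℕ} (hL : 0 < L)
    (hk₀ : dyadicIntCl j₀ (k₀ : ℤ) ⊆ Icc 0 1)
    (hgβ : ∀ z ∈ dyadicIntCl j₀ (k₀ : ℤ), |g z - β| ≤ δ / 2) (hC : C ≤ L * (δ / 2))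
    (hw₁ : ∀ c < N, w₁ c < 2 ^ L ∧ L * (β + δ) ≤ birkSum φ L (dyadicPt L (w₁ c)))
    (hw₂ : ∀ c < N, w₂ c < 2 ^ L ∧ birkSum φ L (dyadicPt L (w₂ c)) ≤ L * (β - δ))
    {κ : ℕ → ℕ} {y : ℝ} (hκ0 : κ 0 = k₀)
    (hκ : ∀ n, ∃ c < N, κ (n + 1) = 2 ^ L * κ n + steeringRule φ g j₀ L w₁ w₂ n (κ n) c)
    (hy : ∀ n, y ∈ dyadicIntCl (j₀ + n * L) (κ n : ℤ)) :
    Tendsto (fun j : ℕ => birkSum φ j y / j) atTop (𝓝 (g y)) := by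
  set M : ℕ → ℝ := fun n => ((j₀ + n * L : ℕ) : ℝ) with hM
  set u : ℕ → ℝ := fun n => dyadicPt (j₀ + n * L) (κ n) with hu
  set X : ℕ → ℝ := fun n => birkSum φ (j₀ + n * L) (u n) with hX
  have hL0 : (0 : ℝ) < L := by exact_mod_cast hL
  have hMsucc : ∀ n, M (n + 1) = M n + L := fun n => by
    simp only [hM]; push_cast; ring
  have hM0 : ∀ n, 0 ≤ M n := fun n => Nat.cast_nonneg _
  have hMmono : Monotone M := monotone_nat_of_le_succ fun n => by
    rw [hMsucc]; linarith
  have hMt' : Tendsto (fun n => j₀ + n * L) atTop atTop :=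
    tendsto_atTop_mono (fun n => (Nat.le_mul_of_pos_right n hL).trans (Nat.le_add_left _ _))
      tendsto_id
  have hMt : Tendsto M atTop atTop := tendsto_natCast_atTop_atTop.comp hMt'
  -- the son chosen at each step is a legitimate word
  have hrule : ∀ n, ∃ v < 2 ^ L, κ (n + 1) = 2 ^ L * κ n + v ∧
      ((X n ≤ M n * g (u n) ∧ L * (β + δ) ≤ birkSum φ L (dyadicPt L v)) ∨
        (M n * g (u n) < X n ∧ birkSum φ L (dyadicPt L v) ≤ L * (β - δ))) := by
    intro n
    obtain ⟨c, hc, hκn⟩ := hκ n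
    refine ⟨_, ?_, hκn, ?_⟩ <;> unfold steeringRule <;> split_ifs with hif
    · exact (hw₁ c hc).1
    · exact (hw₂ c hc).1
    · exact Or.inl ⟨hif, (hw₁ c hc).2⟩
    · exact Or.inr ⟨not_le.1 hif, (hw₂ c hc).2⟩
  have hXsucc : ∀ n v, v < 2 ^ L → κ (n + 1) = 2 ^ L * κ n + v →
      |X (n + 1) - (X n + birkSum φ L (dyadicPt L v))| ≤ C := by
    intro n v hv hκv
    have := abs_birkSum_concat_le h hper (j₀ + n * L) L (κ n) hv
    rw [← hκv, show j₀ + n * L + L = j₀ + (n + 1) * L by ring] at this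
    exact this
  have hu_mem : ∀ n, u n ∈ dyadicIntCl j₀ (k₀ : ℤ) := by
    have hsub : ∀ n, dyadicIntCl (j₀ + n * L) (κ n : ℤ) ⊆ dyadicIntCl j₀ (k₀ : ℤ) := by
      intro n
      induction n with
      | zero => rw [hκ0]; simp
      | succ n ih =>
        obtain ⟨v, hv, hκv, -⟩ := hrule n
        rw [hκv, show j₀ + (n + 1) * L = j₀ + n * L + L by ring]
        exact (dyadicIntCl_concat_subset _ _ _ hv).trans ih
    exact fun n => hsub n (dyadicPt_mem_dyadicIntCl _ _)
  have hy₀ : y ∈ dyadicIntCl j₀ (k₀ : ℤ) := by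
    have := hy 0
    rwa [hκ0, Nat.zero_mul, add_zero] at this
  have hdist : ∀ n, |y - u n| ≤ ((2 : ℝ) ^ (j₀ + n * L))⁻¹ := fun n =>
    abs_sub_le_of_mem_dyadicIntCl (hy n) (dyadicPt_mem_dyadicIntCl _ _)
  have hgu : Tendsto (fun n => g (u n)) atTop (𝓝 (g y)) := by
    refine (hg y (hk₀ hy₀)).tendsto.comp (tendsto_nhdsWithin_iff.2
      ⟨?_, Eventually.of_forall fun n => hk₀ (hu_mem n)⟩)
    rw [tendsto_iff_dist_tendsto_zero]
    refine squeeze_zero (fun _ => dist_nonneg) (fun n => ?_) (tendsto_inv_two_pow.comp hMt')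
    rw [dist_comm, Real.dist_eq]
    exact hdist n
  have hβy := abs_le.1 (hgβ y hy₀)
  set D : ℕ → ℝ := fun n => X n - M n * g y with hD
  have hDR : ∀ n, |D (n + 1) - D n| ≤ C + L * B + L * |g y| := by
    intro n
    obtain ⟨v, hv, hκv, -⟩ := hrule n
    have h1 := abs_le.1 (hXsucc n v hv hκv)
    have h2 := abs_le.1 (abs_birkSum_le hB L (dyadicPt L v))
    have h3 := mul_le_mul_of_nonneg_left (le_abs_self (g y)) hL0.le
    have h4 := mul_le_mul_of_nonneg_left (neg_abs_le (g y)) hL0.le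
    simp only [hD, hMsucc]
    rw [abs_le]
    constructor <;> linarith [h1.1, h1.2, h2.1, h2.2]
  have hclose : ∀ η > 0, ∀ᶠ n in atTop, |M n * g (u n) - M n * g y| ≤ η * M n := by
    intro η hη
    filter_upwards [hgu.eventually (Metric.closedBall_mem_nhds _ hη)] with n hn
    rw [← mul_sub, abs_mul, abs_of_nonneg (hM0 n), mul_comm]
    exact mul_le_mul_of_nonneg_right hn (hM0 n)
  have hlow : ∀ ε > 0, ∀ᶠ n in atTop, -(ε * M n) ≤ D n := fun ε hε => by
    refine eventually_neg_mul_le_of_steering hMmono hMt hDR (fun η hη => ?_) hε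
    filter_upwards [hclose η hη] with n hn hlt
    rw [abs_le] at hn
    obtain ⟨v, hv, hκv, ⟨-, hS⟩ | ⟨hgt, -⟩⟩ := hrule n
    · have h1 := abs_le.1 (hXsucc n v hv hκv)
      have h2 := mul_le_mul_of_nonneg_left (show g y ≤ β + δ / 2 by linarith) hL0.le
      simp only [hD, hMsucc]
      linarith
    · simp only [hD] at hlt
      linarith
  have hup : ∀ ε > 0, ∀ᶠ n in atTop, -(ε * M n) ≤ -D n := fun ε hε => by
    refine eventually_neg_mul_le_of_steering (D := fun n => -D n)
      (R := C + L * B + L * |g y|) hMmono hMt (fun n => ?_) (fun η hη => ?_) hε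
    · rw [neg_sub_neg, abs_sub_comm]; exact hDR n
    filter_upwards [hclose η hη] with n hn hlt
    rw [abs_le] at hn
    obtain ⟨v, hv, hκv, ⟨hle, -⟩ | ⟨-, hS⟩⟩ := hrule n
    · simp only [hD] at hlt
      linarith
    · have h1 := abs_le.1 (hXsucc n v hv hκv)
      have h2 := mul_le_mul_of_nonneg_left (show β - δ / 2 ≤ g y by linarith) hL0.le
      simp only [hD, hMsucc]
      linarith
  refine tendsto_birkSum_div_of_bounded_gaps hB hL (X := X) (C := C)
    (fun n => h _ _ _ (hdist n)) fun ε hε => ?_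
  filter_upwards [hlow ε hε, hup ε hε] with n h1 h2
  rw [abs_le]
  exact ⟨h1, by linarith⟩

/-! ### The local multifractal formalism -/

lemma mul_log_two_mem_Icc_of_birkExp_eq {φ γ θ : ℝ → ℝ} {B C : ℝ} (hB : ∀ x, |φ x| ≤ B)
    (h : BoundedDistortion φ C) (hγc : ContinuousOn γ (Icc 0 1))
    (hγpos : ∀ t ∈ Icc (0 : ℝ) 1, 0 < γ t) (hθc : ContinuousOn θ (Icc 0 1)) {Pr : ℝ → ℝ}
    (hP : ∀ q, Tendsto (fun j : ℕ => Real.log (birkZ φ q j) / j) atTop (𝓝 (Pr q))) {Am Ap : ℝ}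
    (hAm : Tendsto (fun q : ℝ => Pr q / q) atBot (𝓝 Am))
    (hAp : Tendsto (fun q : ℝ => Pr q / q) atTop (𝓝 Ap)) {y : ℝ} (hy : y ∈ Ioo (0 : ℝ) 1) {H : ℝ}
    (hH : birkExp φ γ θ y = (H : EReal)) :
    H * Real.log 2 ∈ Icc (γ y * Am + θ y) (γ y * Ap + θ y) := by
  have hγ := hγpos y (Ioo_subset_Icc_self hy)
  have hy' := Ioo_subset_Ico_self hy
  constructor <;> refine le_of_forall_pos_le_add fun η hη => ?_ <;>
    set ε := η / (γ y + 1) with hε <;>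
    have hε0 : 0 < ε := by positivity
  all_goals
    have hεη : γ y * ε + ε = η := by rw [hε]; field_simp
    have hf := frequently_abs_sub_lt_of_birkExp_eq hB h hγc hγpos hθc hy hH hε0
  · obtain ⟨j, hj1, hj2⟩ := (hf.and_eventually
      (eventually_lt_birkSum_div h hP hAm hy' (show Am - ε < Am by linarith))).exists
    have := mul_lt_mul_of_pos_left hj2 hγ
    linarith [(abs_lt.1 hj1).2]
  · obtain ⟨j, hj1, hj2⟩ := (hf.and_eventually
      (eventually_birkSum_div_lt h hP hAp hy' (show Ap < Ap + ε by linarith))).exists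
    have := mul_lt_mul_of_pos_left hj2 hγ
    linarith [(abs_lt.1 hj1).1]

lemma exists_ball_birkExp_ne {φ γ θ : ℝ → ℝ} {B C : ℝ} (hB : ∀ x, |φ x| ≤ B)
    (h : BoundedDistortion φ C) (hγc : ContinuousOn γ (Icc 0 1))
    (hγpos : ∀ t ∈ Icc (0 : ℝ) 1, 0 < γ t) (hθc : ContinuousOn θ (Icc 0 1)) {Pr : ℝ → ℝ}
    (hP : ∀ q, Tendsto (fun j : ℕ => Real.log (birkZ φ q j) / j) atTop (𝓝 (Pr q))) {Am Ap : ℝ}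
    (hAm : Tendsto (fun q : ℝ => Pr q / q) atBot (𝓝 Am))
    (hAp : Tendsto (fun q : ℝ => Pr q / q) atTop (𝓝 Ap)) {x : ℝ} (hx : x ∈ Ioo (0 : ℝ) 1) {H : ℝ}
    (hH : H * Real.log 2 ∉ Icc (γ x * Am + θ x) (γ x * Ap + θ x)) :
    ∃ r : ℝ, 0 < r ∧ ∀ y ∈ ball x r ∩ Ioo (0 : ℝ) 1, birkExp φ γ θ y ≠ (H : EReal) := by
  have hIcc : Icc (0 : ℝ) 1 ∈ 𝓝 x := Icc_mem_nhds hx.1 hx.2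
  have hcont : ∀ a : ℝ, Tendsto (fun y => γ y * a + θ y) (𝓝 x) (𝓝 (γ x * a + θ x)) := fun a =>
    ((hγc.continuousAt hIcc).tendsto.mul_const a).add (hθc.continuousAt hIcc)
  have hev : ∀ᶠ y in 𝓝 x, H * Real.log 2 ∉ Icc (γ y * Am + θ y) (γ y * Ap + θ y) := by
    by_cases hlow : γ x * Am + θ x ≤ H * Real.log 2
    · have hup : γ x * Ap + θ x < H * Real.log 2 := not_le.1 fun hup => hH ⟨hlow, hup⟩
      filter_upwards [(hcont Ap).eventually_lt_const hup] with y hy hmem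
      exact absurd hmem.2 (not_le.2 hy)
    · filter_upwards [(hcont Am).eventually_const_lt (not_le.1 hlow)] with y hy hmem
      exact absurd hmem.1 (not_le.2 hy)
  obtain ⟨r, hr, hball⟩ := Metric.eventually_nhds_iff_ball.1 hev
  exact ⟨r, hr, fun y hy hyH => hball y hy.1
    (mul_log_two_mem_Icc_of_birkExp_eq hB h hγc hγpos hθc hP hAm hAp hy.2 hyH)⟩

lemma birkLocSpectrum_le {φ γ θ : ℝ → ℝ} {B C : ℝ} (hB : ∀ x, |φ x| ≤ B)
    (h : BoundedDistortion φ C) (hγc : ContinuousOn γ (Icc 0 1))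
    (hγpos : ∀ t ∈ Icc (0 : ℝ) 1, 0 < γ t) (hθc : ContinuousOn θ (Icc 0 1)) {q P : ℝ}
    (hP : Tendsto (fun j : ℕ => Real.log (birkZ φ q j) / j) atTop (𝓝 P))
    {x : ℝ} (hx : x ∈ Ioo (0 : ℝ) 1) {H : ℝ} {s : NNReal} (hs : 0 < s)
    (hPs : P - q * ((H * Real.log 2 - θ x) / γ x) < s * Real.log 2) :
    birkLocSpectrum φ γ θ x H ≤ s := by
  have hIcc : Icc (0 : ℝ) 1 ∈ 𝓝 x := Icc_mem_nhds hx.1 hx.2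
  have hgc : Tendsto (fun y => (H * Real.log 2 - θ y) / γ y) (𝓝 x)
      (𝓝 ((H * Real.log 2 - θ x) / γ x)) :=
    ((hθc.continuousAt hIcc).tendsto.const_sub _).div (hγc.continuousAt hIcc)
      (hγpos x (Ioo_subset_Icc_self hx)).ne'
  set β := (H * Real.log 2 - θ x) / γ x with hβ
  obtain ⟨ε, hε, hεs⟩ : ∃ ε > 0, P - (q * β - ε) < s * Real.log 2 :=
    ⟨(s * Real.log 2 - (P - q * β)) / 2, by linarith, by linarith⟩
  set η := ε / (2 * (|q| + 1)) with hη
  have hη0 : 0 < η := by positivity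
  have hqη : |q| * (2 * η) ≤ ε := by
    have : (|q| + 1) * (2 * η) = ε := by rw [hη]; field_simp
    linarith
  obtain ⟨r, hr, hball⟩ := Metric.eventually_nhds_iff_ball.1
    (hgc.eventually (Metric.ball_mem_nhds _ hη0))
  refine (iInf₂_le r hr).trans ((dimH_mono ?_).trans (dimH_setOf_frequently_le h hP hs hεs))
  rintro y ⟨⟨hyr, hy⟩, hyH⟩
  have hγ := hγpos y (Ioo_subset_Icc_self hy)
  refine ⟨hy, ((frequently_abs_sub_lt_of_birkExp_eq hB h hγc hγpos hθc hy hyH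
    (mul_pos hγ hη0)).and_eventually (eventually_gt_atTop 0)).mono fun j hj => ?_⟩
  obtain ⟨hj1, hj0⟩ := hj
  have hj0 : (0 : ℝ) < j := by exact_mod_cast hj0
  have h1 : |birkSum φ j y / j - (H * Real.log 2 - θ y) / γ y| < η := by
    have h2 : γ y * (birkSum φ j y / j) + θ y - H * Real.log 2 =
        γ y * (birkSum φ j y / j - (H * Real.log 2 - θ y) / γ y) := by
      rw [mul_sub, mul_div_cancel₀ _ hγ.ne']; ring
    rw [h2, abs_mul, abs_of_pos hγ] at hj1
    exact lt_of_mul_lt_mul_left hj1 hγ.le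
  have h3 : |(H * Real.log 2 - θ y) / γ y - β| < η := hball y hyr
  have h4 : |birkSum φ j y / j - β| ≤ 2 * η := by
    rw [abs_lt] at h1 h3
    rw [abs_le]
    constructor <;> linarith [h1.1, h1.2, h3.1, h3.2]
  have h5 : |q * (birkSum φ j y / j - β)| ≤ ε := by
    rw [abs_mul]
    exact (mul_le_mul_of_nonneg_left h4 (abs_nonneg q)).trans hqη
  have h6 : q * β - ε ≤ q * (birkSum φ j y / j) := by linarith [(abs_le.1 h5).1]
  calc (j : ℝ) * (q * β - ε) ≤ j * (q * (birkSum φ j y / j)) :=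
        mul_le_mul_of_nonneg_left h6 hj0.le
    _ = q * birkSum φ j y := by field_simp

lemma le_birkLocSpectrum {φ γ θ : ℝ → ℝ} {B C : ℝ} (hB : ∀ x, |φ x| ≤ B)
    (h : BoundedDistortion φ C) (hper : ∀ x, φ (x + 1) = φ x) (hγc : ContinuousOn γ (Icc 0 1))
    (hγpos : ∀ t ∈ Icc (0 : ℝ) 1, 0 < γ t) (hθc : ContinuousOn θ (Icc 0 1)) {Pr : ℝ → ℝ}
    (hP : ∀ q, Tendsto (fun j : ℕ => Real.log (birkZ φ q j) / j) atTop (𝓝 (Pr q))) {Am Ap : ℝ}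
    (hp : ∀ q, 0 ≤ q → q * Ap ≤ Pr q) (hm : ∀ q, q ≤ 0 → q * Am ≤ Pr q)
    {x : ℝ} (hx : x ∈ Ioo (0 : ℝ) 1) {H s σ : ℝ}
    (hβ : (H * Real.log 2 - θ x) / γ x ∈ Ioo Am Ap) (hs : 0 < s) (hsσ : s * Real.log 2 < σ)
    (hlow : ∀ q, σ ≤ Pr q - q * ((H * Real.log 2 - θ x) / γ x)) :
    ENNReal.ofReal s ≤ birkLocSpectrum φ γ θ x H := by
  obtain ⟨δ, L, b, w₁, w₂, hδ, hL, hb, hsb, hC, hw₁, hw₂, hw₁', hw₂'⟩ :=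
    exists_words h hper hP hp hm hβ hs hsσ hlow
  set g : ℝ → ℝ := fun y => (H * Real.log 2 - θ y) / γ y with hg
  have hgc : ContinuousOn g (Icc 0 1) :=
    (continuousOn_const.sub hθc).div hγc fun t ht => (hγpos t ht).ne'
  have hIcc : Icc (0 : ℝ) 1 ∈ 𝓝 x := Icc_mem_nhds hx.1 hx.2
  obtain ⟨r', hr', hball⟩ := Metric.eventually_nhds_iff_ball.1
    ((hgc.continuousAt hIcc).eventually (Metric.closedBall_mem_nhds _ (half_pos hδ)))
  refine le_iInf₂ fun r hr => ?_
  obtain ⟨j₀, k₀, -, hsub⟩ := exists_dyadicIntCl_subset hx (lt_min hr hr')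
  have hL0 : (0 : ℝ) < L := by exact_mod_cast hL
  refine le_trans ?_ (div_le_dimH_of_forall_mem (j₀ := j₀) (k₀ := k₀) hL hb
    (w := steeringRule φ g j₀ L w₁ w₂) (fun n k => ?_) (fun n k c hc => ?_) ?_)
  · refine ENNReal.coe_le_coe.2 (Real.toNNReal_le_iff_le_coe.2 ?_)
    push_cast
    rwa [le_div_iff₀ hL0]
  · unfold steeringRule
    split_ifs
    · exact hw₁
    · exact hw₂
  · unfold steeringRule
    split_ifs
    · exact (hw₁' c hc).1
    · exact (hw₂' c hc).1
  · intro κ y hκ0 hκ hy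
    have hy₀ : y ∈ dyadicIntCl j₀ (k₀ : ℤ) := by
      have := hy 0
      rwa [hκ0, Nat.zero_mul, add_zero] at this
    have hyx := hsub hy₀
    have hlim := tendsto_birkSum_div_of_steeringRule hB h hper hgc hL
      (fun z hz => Ioo_subset_Icc_self (hsub hz).2)
      (fun z hz => hball z (ball_subset_ball (min_le_right _ _) (hsub hz).1)) hC hw₁' hw₂'
      hκ0 hκ hy
    refine ⟨⟨ball_subset_ball (min_le_left _ _) hyx.1, hyx.2⟩, ?_⟩
    rw [birkExp_eq_of_tendsto hB h hγc hγpos hθc hyx.2 hlim]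
    have hγ := hγpos y (Ioo_subset_Icc_self hyx.2)
    have hl2 : 0 < Real.log 2 := Real.log_pos (by norm_num)
    rw [hg, mul_div_cancel₀ _ hγ.ne', sub_add_cancel, mul_div_cancel_right₀ _ hl2.ne']

lemma birkLocSpectrum_eq_iInf {φ γ θ : ℝ → ℝ} {B C : ℝ} (hB : ∀ x, |φ x| ≤ B)
    (h : BoundedDistortion φ C) (hper : ∀ x, φ (x + 1) = φ x) (hγc : ContinuousOn γ (Icc 0 1))
    (hγpos : ∀ t ∈ Icc (0 : ℝ) 1, 0 < γ t) (hθc : ContinuousOn θ (Icc 0 1)) {Pr : ℝ → ℝ}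
    (hP : ∀ q, Tendsto (fun j : ℕ => Real.log (birkZ φ q j) / j) atTop (𝓝 (Pr q))) {Am Ap : ℝ}
    (hAm : Tendsto (fun q : ℝ => Pr q / q) atBot (𝓝 Am))
    (hAp : Tendsto (fun q : ℝ => Pr q / q) atTop (𝓝 Ap)) {x : ℝ} (hx : x ∈ Ioo (0 : ℝ) 1) {H : ℝ}
    (hH : H * Real.log 2 ∈ Ioo (γ x * Am + θ x) (γ x * Ap + θ x)) :
    (birkLocSpectrum φ γ θ x H : EReal) =
      ⨅ p : ℝ, ((H * p - birkLocScalingFn φ γ θ x p : ℝ) : EReal) := by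
  have hγ := hγpos x (Ioo_subset_Icc_self hx)
  have hl2 : 0 < Real.log 2 := Real.log_pos (by norm_num)
  have hp : ∀ q, 0 ≤ q → q * Ap ≤ Pr q := fun q hq => mul_le_pressure_of_nonneg hP hAp hq
  have hm : ∀ q, q ≤ 0 → q * Am ≤ Pr q := fun q hq => mul_le_pressure_of_nonpos hP hAm hq
  set β := (H * Real.log 2 - θ x) / γ x with hβ
  have hβmem : β ∈ Ioo Am Ap := by
    constructor
    · rw [hβ, lt_div_iff₀ hγ]; linarith [hH.1]
    · rw [hβ, div_lt_iff₀ hγ]; linarith [hH.2]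
  have hval : ∀ p, H * p - birkLocScalingFn φ γ θ x p =
      (Pr (-p * γ x) - -p * γ x * β) / Real.log 2 := fun p => by
    rw [birkLocScalingFn_eq hB h hper hγc hγpos hθc hx (hP (-p * γ x)), hβ]
    field_simp
    ring
  have hnonneg : ∀ q, 0 ≤ Pr q - q * β := fun q => by
    rcases le_total 0 q with hq | hq
    · nlinarith [hp q hq, hβmem.2]
    · nlinarith [hm q hq, hβmem.1]
  apply le_antisymm
  · refine le_iInf fun p => ?_
    rw [hval]
    set v := (Pr (-p * γ x) - -p * γ x * β) / Real.log 2 with hv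
    have hv0 : 0 ≤ v := div_nonneg (hnonneg _) hl2.le
    have hle : birkLocSpectrum φ γ θ x H ≤ ENNReal.ofReal v := by
      refine ENNReal.le_of_forall_pos_le_add fun ε hε _ => ?_
      have := birkLocSpectrum_le hB h hγc hγpos hθc (hP (-p * γ x)) hx (H := H)
        (s := v.toNNReal + ε) (by positivity) (by
          push_cast
          rw [Real.coe_toNNReal v hv0, add_mul, hv, div_mul_cancel₀ _ hl2.ne']
          have : 0 < (ε : ℝ) * Real.log 2 := mul_pos (by exact_mod_cast hε) hl2
          linarith)
      rwa [ENNReal.coe_add] at this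
    calc (birkLocSpectrum φ γ θ x H : EReal) ≤ (ENNReal.ofReal v : EReal) :=
          EReal.coe_ennreal_le_coe_ennreal_iff.2 hle
      _ = (v : EReal) := by rw [EReal.coe_ennreal_ofReal, max_eq_left hv0]
  · refine le_of_forall_lt_imp_le_of_dense fun c hc => ?_
    obtain ⟨d, hcd, hd⟩ := EReal.lt_iff_exists_real_btwn.1 hc
    rcases le_or_gt c 0 with hc0 | hc0
    · exact hc0.trans (EReal.coe_ennreal_nonneg _)
    lift c to ℝ using ⟨(hcd.trans (EReal.coe_lt_top d)).ne, (EReal.bot_lt_zero.trans hc0).ne'⟩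
    have hc0 : 0 < c := by exact_mod_cast hc0
    have hcd : c < d := by exact_mod_cast hcd
    have hle := le_birkLocSpectrum hB h hper hγc hγpos hθc hP hp hm hx (H := H) (s := c)
      (σ := d * Real.log 2) hβmem hc0 (mul_lt_mul_of_pos_right hcd hl2) (fun q => by
        have h1 := hd.le.trans (iInf_le _ (-(q / γ x)))
        rw [EReal.coe_le_coe_iff, hval, neg_neg, div_mul_cancel₀ _ hγ.ne',
          le_div_iff₀ hl2] at h1
        exact h1)
    calc (c : EReal) = (ENNReal.ofReal c : EReal) := by
          rw [EReal.coe_ennreal_ofReal, max_eq_left hc0.le]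
      _ ≤ _ := EReal.coe_ennreal_le_coe_ennreal_iff.2 hle

/-- Fix `x ∈ (0,1)` and `H ∈ ℝ`.
(i) If `H log 2 ∉ [γ(x)A₋ + θ(x), γ(x)A₊ + θ(x)]`, then there is `r > 0` such that
no `y ∈ B(x,r) ∩ (0,1)` satisfies `h_E(y) = H`.
(ii) If `H log 2 ∈ (γ(x)A₋ + θ(x), γ(x)A₊ + θ(x))`, then the local multifractal
formalism holds at `x`: `d_E(x,H) = inf_{p∈ℝ} (H p − τ_E(x,p))`. -/
theorem birk_local_multifractal_formalism (φ γ θ : ℝ → ℝ)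
    (hφHolder : ∃ Cφ α : ℝ, 0 < Cφ ∧ 0 < α ∧ α ≤ 1 ∧
      ∀ x y : ℝ, |φ x - φ y| ≤ Cφ * |x - y| ^ α)
    (hφper : ∀ x : ℝ, φ (x + 1) = φ x)
    (hγc : ContinuousOn γ (Set.Icc 0 1))
    (hγpos : ∀ t ∈ Set.Icc (0 : ℝ) 1, 0 < γ t)
    (hθc : ContinuousOn θ (Set.Icc 0 1))
    (Pr : ℝ → ℝ)
    (hPr : ∀ q : ℝ, Filter.Tendsto
      (fun j : ℕ => (1 / (j : ℝ)) * Real.log (pressureSum φ q j))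
      Filter.atTop (nhds (Pr q)))
    (hNotAffine : ¬ ∃ m c : ℝ, ∀ q : ℝ, Pr q = m * q + c)
    (Am Ap : ℝ)
    (hAm : Filter.Tendsto (fun q : ℝ => Pr q / q) Filter.atBot (nhds Am))
    (hAp : Filter.Tendsto (fun q : ℝ => Pr q / q) Filter.atTop (nhds Ap))
    (x : ℝ) (hx : x ∈ Set.Ioo (0 : ℝ) 1) (H : ℝ) :
    (H * Real.log 2 ∉ Set.Icc (γ x * Am + θ x) (γ x * Ap + θ x) →
        ∃ r : ℝ, 0 < r ∧
          ∀ y ∈ Metric.ball x r ∩ Set.Ioo (0 : ℝ) 1, birkExp φ γ θ y ≠ (H : EReal)) ∧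
      (H * Real.log 2 ∈ Set.Ioo (γ x * Am + θ x) (γ x * Ap + θ x) →
        (birkLocSpectrum φ γ θ x H : EReal)
          = ⨅ p : ℝ, ((H * p - birkLocScalingFn φ γ θ x p : ℝ) : EReal)) := by
  obtain ⟨B, -, hB⟩ := exists_abs_le_of_holder_periodic hφHolder hφper
  obtain ⟨C, -, h⟩ := exists_distortion_of_holder hφHolder
  have hP : ∀ q, Tendsto (fun j : ℕ => Real.log (birkZ φ q j) / j) atTop (𝓝 (Pr q)) :=
    fun q => tendsto_log_birkZ h (hPr q)
  exact ⟨exists_ball_birkExp_ne hB h hγc hγpos hθc hP hAm hAp hx,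
    birkLocSpectrum_eq_iInf hB h hφper hγc hγpos hθc hP hAm hAp hx⟩

end
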